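/- arXiv:1309.4984 — 5 statements merged into one kernel-verified Lean document; each statement's English description precedes it below -/
import Mathlib

section
/- (Boll-type convolution theorem without absolute continuity.) Let P and Q be probability measures on ℝ^d such that the characteristic function of P is nonzero everywhere, and suppose there is a Markov kernel K from ℝ^d to ℝ^d with Q ∗ ε_θ(B) = ∫ K(x, B) d(P ∗ ε_θ)(x) for all θ ∈ ℝ^d and all Borel sets B. Then there exists a probability measure ν on ℝ^d with Q = ν ∗ P. -/
open MeasureTheory ProbabilityTheory

section Averaging

open Filter Metric Module
open scoped Topology RealInnerProductSpace

variable {E : Type*} [NormedAddCommGroup E] [InnerProductSpace ℝ E] [FiniteDimensional ℝ E]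
  [MeasurableSpace E] [BorelSpace E]

/-- The integrals of a bounded function over a ball and over a translate of it differ by at most
the volume of a surrounding shell. -/
lemma norm_setIntegral_ball_translate_sub_le {h : E → ℂ} (hm : Measurable h) {C : ℝ}
    (hC : ∀ x, ‖h x‖ ≤ C) (x : E) (R : ℝ) :
    ‖(∫ θ in ball (0 : E) R, h (x + θ)) - ∫ θ in ball (0 : E) R, h θ‖ ≤
      2 * C * (volume.real (ball (0 : E) (R + ‖x‖)) - volume.real (ball (0 : E) R)) := by
  have hball (y : E) (hy : ‖y‖ ≤ ‖x‖) :
      ‖(∫ θ in ball (0 : E) (R + ‖x‖), h θ) - ∫ θ in ball y R, h θ‖ ≤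
        C * (volume.real (ball (0 : E) (R + ‖x‖)) - volume.real (ball (0 : E) R)) := by
    have hsub : ball y R ⊆ ball (0 : E) (R + ‖x‖) :=
      ball_subset_ball' (by rw [dist_zero_right]; linarith)
    have hint : IntegrableOn h (ball (0 : E) (R + ‖x‖)) :=
      Measure.integrableOn_of_bounded measure_ball_lt_top.ne hm.aestronglyMeasurable
        (M := C) (ae_of_all _ hC)
    rw [← setIntegral_sdiff measurableSet_ball hint hsub]
    refine (norm_setIntegral_le_of_norm_le_const
      ((measure_mono Set.sdiff_subset).trans_lt measure_ball_lt_top) (fun z _ => hC z)).trans_eq ?_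
    rw [measureReal_sdiff hsub measurableSet_ball,
      Measure.addHaar_real_ball_center _ y]
  have htrans : ∫ θ in ball (0 : E) R, h (x + θ) = ∫ θ in ball x R, h θ := by
    rw [← (measurePreserving_add_left volume x).setIntegral_preimage_emb
      (measurableEmbedding_addLeft x) h (ball x R), preimage_add_ball, sub_self]
  rw [htrans]
  calc _ = ‖((∫ θ in ball (0 : E) (R + ‖x‖), h θ) - ∫ θ in ball 0 R, h θ) -
        ((∫ θ in ball (0 : E) (R + ‖x‖), h θ) - ∫ θ in ball x R, h θ)‖ := by
        congr 1; ring
    _ ≤ _ := (norm_sub_le _ _).trans (by linarith [hball 0 (by simp), hball x le_rfl])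

lemma isProbabilityMeasure_cond_ball {R : ℝ} (hR : 0 < R) :
    IsProbabilityMeasure (volume[|ball (0 : E) R]) :=
  cond_isProbabilityMeasure_of_finite (measure_ball_pos _ _ hR).ne' measure_ball_lt_top.ne

/-- Averages of a bounded function over large balls are asymptotically translation invariant. -/
lemma tendsto_integral_cond_ball_translate_sub {h : E → ℂ} (hm : Measurable h) {C : ℝ}
    (hC : ∀ x, ‖h x‖ ≤ C) (x : E) :
    Tendsto (fun n : ℕ => (∫ θ, h (x + θ) ∂(volume[|ball (0 : E) (n + 1)])) -
      ∫ θ, h θ ∂(volume[|ball (0 : E) (n + 1)])) atTop (𝓝 0) := by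
  have hlim : Tendsto (fun n : ℕ => 2 * C * ((1 + ‖x‖ / ((n : ℝ) + 1)) ^ finrank ℝ E - 1))
      atTop (𝓝 0) := by
    have h0 : Tendsto (fun n : ℕ => ‖x‖ / ((n : ℝ) + 1)) atTop (𝓝 0) :=
      tendsto_const_nhds.div_atTop
        (tendsto_atTop_add_const_right _ _ tendsto_natCast_atTop_atTop)
    simpa using (((h0.const_add 1).pow (finrank ℝ E)).sub_const 1).const_mul (2 * C)
  refine squeeze_zero_norm (fun n => ?_) hlim
  have hR : (0 : ℝ) < n + 1 := by positivity
  have hvol (r : ℝ) (hr : 0 < r) : volume.real (ball (0 : E) r) =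
      r ^ finrank ℝ E * volume.real (ball (0 : E) 1) := by
    rw [measureReal_def, Measure.addHaar_ball_of_pos _ _ hr, ENNReal.toReal_mul,
      ENNReal.toReal_ofReal (by positivity), measureReal_def]
  have h1 : 0 < volume.real (ball (0 : E) 1) :=
    ENNReal.toReal_pos (measure_ball_pos _ _ one_pos).ne' measure_ball_lt_top.ne
  simp only [ProbabilityTheory.cond, integral_smul_measure]
  rw [← smul_sub, norm_smul, ENNReal.toReal_inv, ← measureReal_def, Real.norm_of_nonneg
    (by positivity), inv_mul_le_iff₀ (by rw [hvol _ hR]; positivity)]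
  refine (norm_setIntegral_ball_translate_sub_le hm hC x _).trans_eq ?_
  rw [hvol _ hR, hvol _ (by positivity : (0 : ℝ) < n + 1 + ‖x‖)]
  have : (n + 1 + ‖x‖ : ℝ) = (n + 1) * (1 + ‖x‖ / (n + 1)) := by field_simp
  rw [this, mul_pow]
  ring

end Averaging

section Boll

open Filter Metric Module
open scoped Topology RealInnerProductSpace

variable {E : Type*} [NormedAddCommGroup E] [InnerProductSpace ℝ E]
  [MeasurableSpace E]

/-- The characteristic function at `t` of the law of `y - x` when `y` has law `K x`. -/
noncomputable def displacementCharFun (K : Kernel E E) (t x : E) : ℂ :=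
  Complex.exp (-(⟪x, t⟫ * Complex.I)) * charFun (K x) t

lemma norm_displacementCharFun_le_one (K : Kernel E E) [IsMarkovKernel K] (t x : E) :
    ‖displacementCharFun K t x‖ ≤ 1 := by
  rw [displacementCharFun, norm_mul, ← neg_mul, ← Complex.ofReal_neg,
    Complex.norm_exp_ofReal_mul_I, one_mul]
  exact norm_charFun_le_one t

variable [BorelSpace E] [SecondCountableTopology E]

lemma stronglyMeasurable_charFun_kernel (K : Kernel E E) [IsMarkovKernel K] (t : E) :
    StronglyMeasurable fun x => charFun (K x) t := by
  simp only [charFun_apply]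
  exact StronglyMeasurable.integral_kernel (Measurable.stronglyMeasurable (by fun_prop))

lemma measurable_displacementCharFun (K : Kernel E E) [IsMarkovKernel K] (t : E) :
    Measurable (displacementCharFun K t) := by
  unfold displacementCharFun
  have := (stronglyMeasurable_charFun_kernel K t).measurable
  fun_prop

lemma integrable_cexp_inner_mul_I {α : Type*} [MeasurableSpace α] (μ : Measure α)
    [IsFiniteMeasure μ] {f : α → E} (hf : Measurable f) (t : E) :
    Integrable (fun x => Complex.exp (⟪f x, t⟫ * Complex.I)) μ :=
  (integrable_const (1 : ℝ)).mono (by fun_prop) (by simp [Complex.norm_exp_ofReal_mul_I])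

/-- If `θ` has law `m` and `y` has conditional law `K θ`, the characteristic function of the law of
`y - θ` is the mean of the displacement characteristic function. -/
lemma charFun_map_sub_compProd (m : Measure E) [IsProbabilityMeasure m] (K : Kernel E E)
    [IsMarkovKernel K] (t : E) :
    charFun ((m ⊗ₘ K).map (fun p => p.2 - p.1)) t = ∫ θ, displacementCharFun K t θ ∂m := by
  rw [charFun_apply, integral_map (by fun_prop) (by fun_prop), Measure.integral_compProd
    (integrable_cexp_inner_mul_I _ (f := fun p : E × E => p.2 - p.1) (by fun_prop) t)]
  refine integral_congr_ae (ae_of_all _ fun θ => ?_)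
  simp only [displacementCharFun, charFun_apply, ← integral_const_mul]
  refine integral_congr_ae (ae_of_all _ fun y => ?_)
  simp only [← Complex.exp_add, inner_sub_left]
  push_cast
  ring_nf

lemma charFun_bind (μ : Measure E) [IsProbabilityMeasure μ] (K : Kernel E E)
    [IsMarkovKernel K] (t : E) :
    charFun (μ.bind K) t = ∫ x, charFun (K x) t ∂μ := by
  rw [← Measure.snd_compProd, Measure.snd, charFun_apply, integral_map (by fun_prop) (by fun_prop),
    Measure.integral_compProd (integrable_cexp_inner_mul_I _ measurable_snd t)]
  rfl

lemma charFun_eq_integral_displacementCharFun {P Q : Measure E} [IsProbabilityMeasure P]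
    {K : Kernel E E} [IsMarkovKernel K] {θ : E}
    (hK : Q.map (· + θ) = (P.map (· + θ)).bind K) (t : E) :
    charFun Q t = ∫ x, displacementCharFun K t (x + θ) * Complex.exp (⟪x, t⟫ * Complex.I) ∂P := by
  have hP : IsProbabilityMeasure (P.map (· + θ)) :=
    Measure.isProbabilityMeasure_map (by fun_prop)
  have h := congrArg (fun μ => charFun μ t) hK
  simp only at h
  rw [charFun_bind, integral_map (by fun_prop)
    (stronglyMeasurable_charFun_kernel K t).aestronglyMeasurable, charFun_apply,
    integral_map (by fun_prop) (by fun_prop)] at h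
  have h2 : charFun Q t = Complex.exp (-(⟪θ, t⟫ * Complex.I)) *
      ∫ x, Complex.exp (⟪x + θ, t⟫ * Complex.I) ∂Q := by
    rw [← integral_const_mul, charFun_apply]
    congr with x
    rw [← Complex.exp_add, inner_add_left]
    push_cast
    ring_nf
  rw [h2, h, ← integral_const_mul]
  congr with x
  rw [displacementCharFun, mul_right_comm, ← Complex.exp_add, inner_add_left]
  push_cast
  ring_nf

variable [FiniteDimensional ℝ E]

/-- The averages of the displacement characteristic functions over large balls converge to the
quotient of the characteristic functions. -/
lemma tendsto_integral_displacementCharFun {P Q : Measure E} [IsProbabilityMeasure P]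
    {K : Kernel E E} [IsMarkovKernel K]
    (hK : ∀ θ : E, Q.map (· + θ) = (P.map (· + θ)).bind K) {t : E} (ht : charFun P t ≠ 0) :
    Tendsto (fun n : ℕ => ∫ θ, displacementCharFun K t θ ∂(volume[|ball (0 : E) (n + 1)])) atTop
      (𝓝 (charFun Q t / charFun P t)) := by
  set m : ℕ → Measure E := fun n => volume[|ball (0 : E) (n + 1)]
  have hm (n : ℕ) : IsProbabilityMeasure (m n) := isProbabilityMeasure_cond_ball (by positivity)
  set g := displacementCharFun K t
  have hg : Measurable g := measurable_displacementCharFun K t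
  have hg1 (x : E) : ‖g x‖ ≤ 1 := norm_displacementCharFun_le_one K t x
  let e : E → ℂ := fun x => Complex.exp (⟪x, t⟫ * Complex.I)
  have he : Measurable e := by fun_prop
  have he1 (x : E) : ‖e x‖ = 1 := Complex.norm_exp_ofReal_mul_I _
  have hshift (n : ℕ) : Measurable fun x => ∫ θ, g (x + θ) ∂(m n) :=
    (StronglyMeasurable.integral_prod_right' (f := fun p : E × E => g (p.1 + p.2))
      (hg.comp measurable_add).stronglyMeasurable).measurable
  have hshift1 (n : ℕ) (x : E) : ‖∫ θ, g (x + θ) ∂(m n)‖ ≤ 1 :=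
    (norm_integral_le_of_norm_le_const (ae_of_all _ fun θ => hg1 _)).trans_eq (by simp)
  have hmean1 (n : ℕ) : ‖∫ θ, g θ ∂(m n)‖ ≤ 1 :=
    (norm_integral_le_of_norm_le_const (ae_of_all _ hg1)).trans_eq (by simp)
  have hQ (n : ℕ) : charFun Q t = ∫ x, (∫ θ, g (x + θ) ∂(m n)) * e x ∂P := by
    calc charFun Q t = ∫ _, charFun Q t ∂(m n) := by simp
      _ = ∫ θ, ∫ x, g (x + θ) * e x ∂P ∂(m n) := by
        congr with θ
        exact charFun_eq_integral_displacementCharFun (hK θ) t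
      _ = ∫ x, ∫ θ, g (x + θ) * e x ∂(m n) ∂P := by
        refine integral_integral_swap ((integrable_const (1 : ℝ)).mono
          (Measurable.aestronglyMeasurable ?_) (ae_of_all _ fun p => ?_))
        · exact (hg.comp (measurable_snd.add measurable_fst)).mul (he.comp measurable_snd)
        · simpa [Function.uncurry, he1] using hg1 _
      _ = _ := by simp only [integral_mul_const]
  have hdiff (n : ℕ) : ∫ x, ((∫ θ, g (x + θ) ∂(m n)) - ∫ θ, g θ ∂(m n)) * e x ∂P =
      charFun Q t - (∫ θ, g θ ∂(m n)) * charFun P t := by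
    simp only [sub_mul]
    rw [integral_sub, ← hQ n, integral_const_mul]
    · rfl
    · exact (integrable_const (1 : ℝ)).mono ((hshift n).mul he).aestronglyMeasurable
        (ae_of_all _ fun x => by simpa [he1] using hshift1 n x)
    · exact (integrable_cexp_inner_mul_I P measurable_id t).const_mul _
  have hlim : Tendsto (fun n => charFun Q t - (∫ θ, g θ ∂(m n)) * charFun P t) atTop (𝓝 0) := by
    simp only [← hdiff]
    rw [← integral_zero E ℂ (μ := P)]
    refine tendsto_integral_of_dominated_convergence (fun _ => 2)
      (fun n => (((hshift n).sub_const _).mul he).aestronglyMeasurable) (integrable_const _)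
      (fun n => ae_of_all _ fun x => ?_) (ae_of_all _ fun x => ?_)
    · rw [norm_mul, he1, mul_one]
      exact (norm_sub_le _ _).trans (by linarith [hshift1 n x, hmean1 n])
    · simpa using (tendsto_integral_cond_ball_translate_sub hg hg1 x).mul_const (e x)
  have := ((hlim.const_sub (charFun Q t)).div_const (charFun P t))
  simpa [ht] using this

/-- Boll's convolution theorem on a finite-dimensional inner product space. -/
theorem exists_eq_conv_of_map_add_eq_bind {P Q : Measure E} [IsProbabilityMeasure P]
    [IsProbabilityMeasure Q] (hP : ∀ t, charFun P t ≠ 0) {K : Kernel E E} [IsMarkovKernel K]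
    (hK : ∀ θ : E, Q.map (· + θ) = (P.map (· + θ)).bind K) :
    ∃ ν : Measure E, IsProbabilityMeasure ν ∧ Q = ν.conv P := by
  let m : ℕ → Measure E := fun n => volume[|ball (0 : E) (n + 1)]
  have hm (n : ℕ) : IsProbabilityMeasure (m n) := isProbabilityMeasure_cond_ball (by positivity)
  let ν : ℕ → ProbabilityMeasure E := fun n =>
    ⟨(m n ⊗ₘ K).map (fun p => p.2 - p.1), Measure.isProbabilityMeasure_map (by fun_prop)⟩
  have hν (t : E) : Tendsto (fun n => charFun (ν n : Measure E) t) atTop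
      (𝓝 (charFun Q t / charFun P t)) := by
    simpa only [ν, ProbabilityMeasure.coe_mk, charFun_map_sub_compProd]
      using tendsto_integral_displacementCharFun hK (hP t)
  have htight : IsTightMeasureSet (Set.range fun n => (ν n : Measure E)) :=
    isTightMeasureSet_of_tendsto_charFun (f := fun t => charFun Q t / charFun P t)
      (Continuous.continuousAt (by fun_prop (disch := exact hP _))) hν
  have hcompact : IsCompact (closure (Set.range ν)) :=
    isCompact_closure_of_isTightMeasureSet (by simpa [Set.range] using htight)
  obtain ⟨U, hU⟩ := Ultrafilter.exists_le (atTop : Filter ℕ)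
  obtain ⟨ν', -, hν'⟩ := hcompact.ultrafilter_le_nhds (U.map ν)
    (.trans (by simp) (Filter.monotone_principal subset_closure))
  have hchar (t : E) : charFun (ν' : Measure E) t = charFun Q t / charFun P t := by
    refine tendsto_nhds_unique (f := fun n => charFun (ν n : Measure E) t) (l := U) ?_
      ((hν t).mono_left hU)
    have := (ProbabilityMeasure.tendsto_iff_forall_integral_rclike_tendsto ℂ).1
      (show Tendsto ν U (𝓝 ν') from hν') (BoundedContinuousFunction.innerProbChar t)
    simpa only [charFun_eq_integral_innerProbChar] using this
  refine ⟨ν', inferInstance, Measure.ext_of_charFun (funext fun t => ?_)⟩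
  rw [charFun_conv, hchar, div_mul_cancel₀ _ (hP t)]

end Boll

/-- Boll-type convolution theorem on ℝ^d without absolute continuity
(Remark 3.4 (b)). -/
theorem stmt11 {d : ℕ} (P Q : Measure (Fin d → ℝ))
    [IsProbabilityMeasure P] [IsProbabilityMeasure Q]
    (hchar : ∀ t : Fin d → ℝ,
      ∫ x, Complex.exp (Complex.I * ((∑ i, t i * x i : ℝ) : ℂ)) ∂P ≠ 0)
    (K : Kernel (Fin d → ℝ) (Fin d → ℝ)) [IsMarkovKernel K]
    (hK : ∀ θ : Fin d → ℝ,
      Q.map (· + θ) = (P.map (· + θ)).bind (fun x => K x)) :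
    ∃ ν : Measure (Fin d → ℝ), IsProbabilityMeasure ν ∧ Q = Measure.conv ν P := by
  let u : (Fin d → ℝ) → EuclideanSpace ℝ (Fin d) := WithLp.toLp 2
  let v : EuclideanSpace ℝ (Fin d) → (Fin d → ℝ) := WithLp.ofLp
  have hu : Measurable u := by fun_prop
  have hv : Measurable v := by fun_prop
  have hvu (μ : Measure (Fin d → ℝ)) : (μ.map u).map v = μ := by
    rw [Measure.map_map hv hu]; exact Measure.map_id
  have : IsProbabilityMeasure (P.map u) := Measure.isProbabilityMeasure_map hu.aemeasurable
  have : IsProbabilityMeasure (Q.map u) := Measure.isProbabilityMeasure_map hu.aemeasurable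
  let K' := (K.comap v hv).map u
  have : IsMarkovKernel K' := Kernel.IsMarkovKernel.map _ hu
  have hadd (μ : Measure (Fin d → ℝ)) (θ : EuclideanSpace ℝ (Fin d)) :
      (μ.map u).map (· + θ) = (μ.map (· + v θ)).map u := by
    rw [Measure.map_map (by fun_prop) hu, Measure.map_map hu (by fun_prop)]
    rfl
  have hP' (t : EuclideanSpace ℝ (Fin d)) : charFun (P.map u) t ≠ 0 := by
    rw [charFun_apply, integral_map hu.aemeasurable (by fun_prop)]
    convert hchar (v t) using 4 with x
    rw [mul_comm]
    simp [u, v, PiLp.inner_apply]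
  have hK' (θ : EuclideanSpace ℝ (Fin d)) :
      (Q.map u).map (· + θ) = ((P.map u).map (· + θ)).bind K' := by
    rw [hadd, hadd, hK, Measure.map_comp _ _ hu]
    ext s hs
    rw [Measure.bind_apply hs (Kernel.aemeasurable _),
      Measure.bind_apply hs (Kernel.aemeasurable _),
      lintegral_map (Kernel.measurable_coe _ hs) hu]
    simp only [K', Kernel.map_apply _ hu, Kernel.comap_apply]
    rfl
  obtain ⟨ν, hν, hQ⟩ := exists_eq_conv_of_map_add_eq_bind hP' hK'
  refine ⟨ν.map v, Measure.isProbabilityMeasure_map hv.aemeasurable, ?_⟩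
  have hconv := Measure.map_conv_addMonoidHom (μ := ν) (ν := P.map u)
    (WithLp.linearEquiv 2 ℝ (Fin d → ℝ)).toLinearMap.toAddMonoidHom hv
  calc Q = (ν.conv (P.map u)).map v := by rw [← hQ, hvu]
    _ = (ν.map v).conv ((P.map u).map v) := hconv
    _ = (ν.map v).conv P := by rw [hvu]
end

section
/- Let Θ ⊆ ℝ^d be a parameter set whose closure has nonempty interior. Then the Gaussian location family {⊗_{i=1}^d N(θ_i, 1) : θ ∈ Θ} on ℝ^d (product of one-dimensional Gaussian measures with means θ_i and variance 1) is boundedly complete: every bounded measurable φ : ℝ^d → ℝ with ∫ φ d(⊗_{i=1}^d N(θ_i, 1)) = 0 for all θ ∈ Θ vanishes Lebesgue-almost everywhere. -/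
open MeasureTheory ProbabilityTheory

open Filter Topology

/-- Two finite measures all of whose linear functionals have everywhere finite moment generating
functions coinciding near `0` are equal. -/
lemma MeasureTheory.Measure.ext_of_mgf_dual_eventuallyEq {E : Type*} [NormedAddCommGroup E]
    [NormedSpace ℝ E] [MeasurableSpace E] [BorelSpace E] [SecondCountableTopology E]
    [CompleteSpace E] {μ ν : Measure E} [IsFiniteMeasure μ] [IsFiniteMeasure ν]
    (hμ : ∀ L : StrongDual ℝ E, integrableExpSet L μ = Set.univ)
    (hν : ∀ L : StrongDual ℝ E, integrableExpSet L ν = Set.univ)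
    (h : ∀ L : StrongDual ℝ E, mgf L μ =ᶠ[𝓝 0] mgf L ν) : μ = ν := by
  refine Measure.ext_of_charFunDual (funext fun L ↦ ?_)
  have hμL : AnalyticOnNhd ℂ (complexMGF L μ) Set.univ := by
    simpa [hμ L] using analyticOnNhd_complexMGF (X := L) (μ := μ)
  have hνL : AnalyticOnNhd ℂ (complexMGF L ν) Set.univ := by
    simpa [hν L] using analyticOnNhd_complexMGF (X := L) (μ := ν)
  have hfreq : ∃ᶠ z in 𝓝[≠] (0 : ℂ), complexMGF L μ z = complexMGF L ν z := by
    have hreal : ∀ᶠ s : ℝ in 𝓝[≠] 0, complexMGF L μ s = complexMGF L ν s := by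
      filter_upwards [(h L).filter_mono nhdsWithin_le_nhds] with s hs
      rw [complexMGF_ofReal, complexMGF_ofReal, hs]
    have htend : Tendsto (fun s : ℝ ↦ (s : ℂ)) (𝓝[≠] 0) (𝓝[≠] 0) := by
      refine tendsto_nhdsWithin_of_tendsto_nhds_of_eventually_within _ ?_ ?_
      · exact (Complex.continuous_ofReal.tendsto' 0 0 (by simp)).mono_left nhdsWithin_le_nhds
      · filter_upwards [self_mem_nhdsWithin] with s hs
        simpa using hs
    exact htend.frequently hreal.frequently
  have heq := hμL.eqOn_of_preconnected_of_frequently_eq hνL isPreconnected_univ (Set.mem_univ 0)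
    hfreq (Set.mem_univ Complex.I)
  simpa [charFunDual_apply, complexMGF, mul_comm] using heq

section GaussianProduct

variable {ι : Type*} [Fintype ι]

lemma pi_gaussianReal_eq_withDensity (θ : ι → ℝ) :
    Measure.pi (fun i ↦ gaussianReal (θ i) 1) =
      volume.withDensity fun x ↦ ENNReal.ofReal (∏ i, gaussianPDFReal (θ i) 1 (x i)) := by
  refine Measure.pi_eq fun s hs ↦ ?_
  rw [withDensity_apply _ (MeasurableSet.univ_pi hs), volume_pi, Measure.restrict_pi_pi,
    ← ofReal_integral_eq_lintegral_ofReal, integral_fintype_prod_eq_prod,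
    ENNReal.ofReal_prod_of_nonneg]
  · simp_rw [gaussianReal_apply_eq_integral _ one_ne_zero]
  · exact fun i _ ↦ integral_nonneg fun x ↦ gaussianPDFReal_nonneg _ _ _
  · exact Integrable.fintype_prod fun i ↦ (integrable_gaussianPDFReal _ _).restrict
  · exact .of_forall fun x ↦ Finset.prod_nonneg fun i _ ↦ gaussianPDFReal_nonneg _ _ _

lemma measurable_prod_gaussianPDFReal (θ : ι → ℝ) :
    Measurable fun x : ι → ℝ ↦ ∏ i, gaussianPDFReal (θ i) 1 (x i) :=
  Finset.measurable_fun_prod _ fun i _ ↦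
    (measurable_gaussianPDFReal _ _).comp (measurable_pi_apply i)

lemma integral_pi_gaussianReal (θ : ι → ℝ) (f : (ι → ℝ) → ℝ) :
    ∫ x, f x ∂(Measure.pi fun i ↦ gaussianReal (θ i) 1) =
      ∫ x, (∏ i, gaussianPDFReal (θ i) 1 (x i)) * f x := by
  rw [pi_gaussianReal_eq_withDensity, integral_withDensity_eq_integral_toReal_smul
    (measurable_prod_gaussianPDFReal θ).ennreal_ofReal (by simp)]
  refine integral_congr_ae (.of_forall fun x ↦ ?_)
  simp only [smul_eq_mul]
  rw [ENNReal.toReal_ofReal (Finset.prod_nonneg fun i _ ↦ gaussianPDFReal_nonneg _ _ _)]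

lemma volume_absolutelyContinuous_pi_gaussianReal (θ : ι → ℝ) :
    volume ≪ Measure.pi (fun i ↦ gaussianReal (θ i) 1) := by
  rw [pi_gaussianReal_eq_withDensity]
  refine withDensity_absolutelyContinuous'
    (measurable_prod_gaussianPDFReal θ).ennreal_ofReal.aemeasurable (.of_forall fun x ↦ ?_)
  simpa using Finset.prod_pos fun i _ ↦ gaussianPDFReal_pos (θ i) 1 (x i) one_ne_zero

lemma gaussianPDFReal_add_mean (t h x : ℝ) :
    gaussianPDFReal (t + h) 1 x =
      Real.exp (-(t * h + h ^ 2 / 2)) * (gaussianPDFReal t 1 x * Real.exp (h * x)) := by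
  simp only [gaussianPDFReal]
  rw [mul_assoc _ (Real.exp _), mul_left_comm (Real.exp _), ← Real.exp_add, ← Real.exp_add]
  congr 2
  simp
  ring

lemma integral_pi_gaussianReal_add (t h : ι → ℝ) (f : (ι → ℝ) → ℝ) :
    ∫ x, f x ∂(Measure.pi fun i ↦ gaussianReal (t i + h i) 1) =
      (∏ i, Real.exp (-(t i * h i + h i ^ 2 / 2))) *
        ∫ x, f x * Real.exp (∑ i, h i * x i) ∂(Measure.pi fun i ↦ gaussianReal (t i) 1) := by
  rw [integral_pi_gaussianReal (fun i ↦ t i + h i), integral_pi_gaussianReal t,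
    ← integral_const_mul]
  congr with x
  simp_rw [gaussianPDFReal_add_mean, Finset.prod_mul_distrib, Real.exp_sum]
  ring

lemma integrable_prod_exp_mul_abs_pi_gaussianReal (t : ι → ℝ) (R : ℝ) :
    Integrable (fun x : ι → ℝ ↦ ∏ i, Real.exp (R * |x i|))
      (Measure.pi fun i ↦ gaussianReal (t i) 1) :=
  Integrable.fintype_prod (f := fun _ x ↦ Real.exp (R * |x|)) fun _ ↦
    integrable_exp_mul_abs (X := fun x ↦ x) (integrable_exp_mul_gaussianReal R)
      (integrable_exp_mul_gaussianReal (-R))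

lemma exp_sum_mul_le_prod_exp {h : ι → ℝ} {R : ℝ} (hR : ‖h‖ ≤ R) (x : ι → ℝ) :
    Real.exp (∑ i, h i * x i) ≤ ∏ i, Real.exp (R * |x i|) := by
  rw [← Real.exp_sum]
  refine Real.exp_le_exp.2 (Finset.sum_le_sum fun i _ ↦ (le_abs_self _).trans ?_)
  rw [abs_mul]
  gcongr
  exact (norm_le_pi_norm h i).trans hR

lemma integrable_exp_sum_mul_pi_gaussianReal (t h : ι → ℝ) :
    Integrable (fun x : ι → ℝ ↦ Real.exp (∑ i, h i * x i))
      (Measure.pi fun i ↦ gaussianReal (t i) 1) := by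
  refine (integrable_prod_exp_mul_abs_pi_gaussianReal t ‖h‖).mono'
    (Continuous.aestronglyMeasurable (by fun_prop)) (.of_forall fun x ↦ ?_)
  rw [Real.norm_eq_abs, Real.abs_exp]
  exact exp_sum_mul_le_prod_exp le_rfl x

lemma continuous_integral_mul_exp_pi_gaussianReal (t : ι → ℝ) {φ : (ι → ℝ) → ℝ}
    (hφ : Measurable φ) {C : ℝ} (hC : ∀ x, |φ x| ≤ C) :
    Continuous fun h : ι → ℝ ↦
      ∫ x, φ x * Real.exp (∑ i, h i * x i) ∂(Measure.pi fun i ↦ gaussianReal (t i) 1) := by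
  refine continuous_iff_continuousAt.2 fun h₀ ↦ ?_
  refine continuousAt_of_dominated (bound := fun x ↦ C * ∏ i, Real.exp ((‖h₀‖ + 1) * |x i|))
    (.of_forall fun h ↦ by fun_prop) ?_
    ((integrable_prod_exp_mul_abs_pi_gaussianReal t _).const_mul C)
    (.of_forall fun x ↦ Continuous.continuousAt (by fun_prop))
  have hnear : ∀ᶠ h in 𝓝 h₀, ‖h‖ ≤ ‖h₀‖ + 1 :=
    (continuous_norm.continuousAt.eventually_lt_const (lt_add_one _)).mono fun _ ↦ le_of_lt
  filter_upwards [hnear] with h hh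
  refine .of_forall fun x ↦ ?_
  rw [norm_mul, Real.norm_eq_abs, Real.norm_eq_abs, Real.abs_exp]
  exact mul_le_mul (hC x) (exp_sum_mul_le_prod_exp hh x) (Real.exp_nonneg _)
    ((abs_nonneg _).trans (hC x))

lemma StrongDual.apply_eq_sum_single [DecidableEq ι] (L : StrongDual ℝ (ι → ℝ)) (x : ι → ℝ) :
    L x = ∑ i, L (Pi.single i 1) * x i := by
  conv_lhs => rw [pi_eq_sum_univ' x, map_sum]
  simp [mul_comm]

end GaussianProduct

/-- If the integrals of a bounded function against `x ↦ exp (∑ i, h i * x i)` vanish for all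
small `h`, where the reference measure is a product of Gaussians, then the function vanishes. -/
lemma ae_eq_zero_of_eventually_integral_mul_exp_eq_zero {ι : Type*} [Fintype ι] (t : ι → ℝ)
    {φ : (ι → ℝ) → ℝ} (hφ : Measurable φ) {C : ℝ} (hC : ∀ x, |φ x| ≤ C)
    (hzero : ∀ᶠ h : ι → ℝ in 𝓝 0,
      ∫ x, φ x * Real.exp (∑ i, h i * x i) ∂(Measure.pi fun i ↦ gaussianReal (t i) 1) = 0) :
    φ =ᵐ[Measure.pi fun i ↦ gaussianReal (t i) 1] 0 := by
  classical
  set γ := Measure.pi fun i ↦ gaussianReal (t i) 1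
  have hexp (L : StrongDual ℝ (ι → ℝ)) (s : ℝ) : Integrable (fun x ↦ Real.exp (s * L x)) γ := by
    convert integrable_exp_sum_mul_pi_gaussianReal t (fun i ↦ s * L (Pi.single i 1)) using 3 with x
    rw [L.apply_eq_sum_single, Finset.mul_sum]
    simp_rw [mul_assoc]
  have hfin {ψ : (ι → ℝ) → ℝ} (hψC : ∀ x, |ψ x| ≤ C) :
      ∫⁻ x, ENNReal.ofReal (ψ x) ∂γ ≠ ⊤ := by
    refine ne_top_of_le_ne_top (b := ∫⁻ _, ENNReal.ofReal C ∂γ) (by simp) ?_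
    exact lintegral_mono fun x ↦ ENNReal.ofReal_le_ofReal ((le_abs_self _).trans (hψC x))
  have hint {ψ : (ι → ℝ) → ℝ} (hψ : Measurable ψ) (hψC : ∀ x, |ψ x| ≤ C)
      (L : StrongDual ℝ (ι → ℝ)) (s : ℝ) :
      Integrable (fun x ↦ (ENNReal.ofReal (ψ x)).toReal * Real.exp (s * L x)) γ := by
    refine (hexp L s).bdd_mul (c := C) hψ.ennreal_ofReal.ennreal_toReal.aestronglyMeasurable (.of_forall fun x ↦ ?_)
    rw [ENNReal.toReal_ofReal', Real.norm_eq_abs, abs_of_nonneg (le_max_right _ _)]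
    exact max_le ((le_abs_self _).trans (hψC x)) ((abs_nonneg _).trans (hψC x))
  have hset {ψ : (ι → ℝ) → ℝ} (hψ : Measurable ψ) (hψC : ∀ x, |ψ x| ≤ C)
      (L : StrongDual ℝ (ι → ℝ)) :
      integrableExpSet L (γ.withDensity fun x ↦ ENNReal.ofReal (ψ x)) = Set.univ := by
    refine Set.eq_univ_of_forall fun s ↦ ?_
    change Integrable _ _
    rw [integrable_withDensity_iff_integrable_smul' hψ.ennreal_ofReal (by simp)]
    exact hint hψ hψC L s
  have hnegC : ∀ x, |(-φ) x| ≤ C := by simpa using hC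
  have hmeas := hφ.ennreal_ofReal
  have hmeas' := hφ.neg.ennreal_ofReal
  have := isFiniteMeasure_withDensity (hfin hC)
  have := isFiniteMeasure_withDensity (hfin hnegC)
  have hmeq : γ.withDensity (fun x ↦ ENNReal.ofReal (φ x)) =
      γ.withDensity (fun x ↦ ENNReal.ofReal ((-φ) x)) := by
    refine Measure.ext_of_mgf_dual_eventuallyEq (hset hφ hC) (hset hφ.neg hnegC) fun L ↦ ?_
    have htend : Tendsto (fun s : ℝ ↦ fun i ↦ s * L (Pi.single i 1)) (𝓝 0) (𝓝 0) := by
      refine Continuous.tendsto' (by fun_prop) _ _ ?_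
      ext
      simp
    filter_upwards [htend.eventually hzero] with s hs
    simp only [mgf]
    rw [integral_withDensity_eq_integral_toReal_smul hmeas (by simp),
      integral_withDensity_eq_integral_toReal_smul hmeas' (by simp), ← sub_eq_zero]
    simp only [smul_eq_mul]
    rw [← integral_sub (hint hφ hC L s) (hint hφ.neg hnegC L s), ← hs]
    congr with x
    rw [← sub_mul, L.apply_eq_sum_single, Finset.mul_sum, ENNReal.toReal_ofReal',
      ENNReal.toReal_ofReal', Pi.neg_apply, max_zero_sub_max_neg_zero_eq_self]
    simp_rw [mul_assoc]
  have hae := (withDensity_eq_iff hmeas.aemeasurable hmeas'.aemeasurable (hfin hC)).1 hmeq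
  filter_upwards [hae] with x hx
  have hx' := congrArg ENNReal.toReal hx
  rw [ENNReal.toReal_ofReal', ENNReal.toReal_ofReal', Pi.neg_apply] at hx'
  rcases le_total (φ x) 0 with h | h <;> simp_all

/-- Bounded completeness of the Gaussian location family on ℝ^d for a parameter set whose
closure has nonempty interior (Example 3.5 (b)). -/
theorem stmt12 {d : ℕ} (Θ : Set (Fin d → ℝ)) (hΘ : (interior (closure Θ)).Nonempty)
    (φ : (Fin d → ℝ) → ℝ) (hφmeas : Measurable φ) (hφbd : ∃ C, ∀ x, |φ x| ≤ C)
    (hzero : ∀ θ ∈ Θ,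
      ∫ x, φ x ∂(Measure.pi fun i => gaussianReal (θ i) 1) = 0) :
    φ =ᵐ[volume] 0 := by
  obtain ⟨C, hC⟩ := hφbd
  obtain ⟨t, ht⟩ := hΘ
  refine (volume_absolutelyContinuous_pi_gaussianReal t).ae_eq
    (ae_eq_zero_of_eventually_integral_mul_exp_eq_zero t hφmeas hC ?_)
  set G : (Fin d → ℝ) → ℝ := fun h ↦
    ∫ x, φ x * Real.exp (∑ i, h i * x i) ∂(Measure.pi fun i ↦ gaussianReal (t i) 1)
  have hG : Continuous G := continuous_integral_mul_exp_pi_gaussianReal t hφmeas hC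
  have hGΘ : Set.EqOn (fun θ ↦ G (θ - t)) 0 Θ := by
    intro θ hθ
    have h := integral_pi_gaussianReal_add t (θ - t) φ
    simp only [Pi.sub_apply, add_sub_cancel, hzero θ hθ] at h
    exact (mul_eq_zero.1 h.symm).resolve_left
      (Finset.prod_ne_zero_iff.2 fun i _ ↦ (Real.exp_pos _).ne')
  have hGcl := hGΘ.closure (by fun_prop) continuous_const
  have hnear : ∀ᶠ h in 𝓝 (0 : Fin d → ℝ), t + h ∈ closure Θ :=
    (Continuous.tendsto' (by fun_prop) (0 : Fin d → ℝ) t (by simp)).eventually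
      (mem_interior_iff_mem_nhds.1 ht)
  filter_upwards [hnear] with h hh
  simpa using hGcl hh
end

section
/- There exist two distinct probability measures μ ≠ ν on ℝ such that μ ∗ η = ν ∗ η for every probability measure η on ℝ whose characteristic function vanishes outside the interval [−1, 1], i.e. φ_η(t) = 0 for all |t| > 1. In particular, convolution factors are in general not unique. -/
open MeasureTheory

lemma integrable_exp_ofReal_mul_I (μ : Measure ℝ) [IsFiniteMeasure μ] (t : ℝ) :
    Integrable (fun x : ℝ ↦ Complex.exp (t * x * Complex.I)) μ := by
  refine Integrable.of_bound (by fun_prop) 1 (.of_forall fun x ↦ ?_)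
  rw [← Complex.ofReal_mul, Complex.norm_exp_ofReal_mul_I]

/-- The symmetric measure on `ℤ ⊆ ℝ` giving mass `1 / n ^ 2` to each `n ≠ 0`. -/
noncomputable def invSqMeasure : Measure ℝ :=
  Measure.sum fun n : ℕ ↦ ENNReal.ofReal (1 / (n : ℝ) ^ 2) •
    (Measure.dirac (n : ℝ) + Measure.dirac (-(n : ℝ)))

instance isFiniteMeasure_invSqMeasure : IsFiniteMeasure invSqMeasure := by
  refine ⟨?_⟩
  have h : Summable fun n : ℕ ↦ 1 / (n : ℝ) ^ 2 :=
    Real.summable_one_div_nat_pow.mpr one_lt_two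
  rw [invSqMeasure, Measure.sum_apply _ MeasurableSet.univ]
  simp only [Measure.smul_apply, Measure.add_apply, measure_univ, smul_eq_mul]
  rw [ENNReal.tsum_mul_right]
  exact ENNReal.mul_lt_top h.tsum_ofReal_lt_top (by simp)

lemma invSqMeasure_singleton_zero : invSqMeasure {0} = 0 := by
  rw [invSqMeasure, Measure.sum_apply _ (measurableSet_singleton 0)]
  refine ENNReal.tsum_eq_zero.mpr fun n ↦ ?_
  rcases eq_or_ne n 0 with rfl | hn
  · simp
  · simp [hn]

lemma hasSum_charFun_invSqMeasure (t : ℝ) :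
    HasSum (fun n : ℕ ↦ ((2 * (1 / (n : ℝ) ^ 2 * Real.cos (n * t)) : ℝ) : ℂ))
      (charFun invSqMeasure t) := by
  rw [charFun_apply_real]
  refine (hasSum_integral_measure (integrable_exp_ofReal_mul_I invSqMeasure t)).congr_fun fun n ↦ ?_
  rw [integral_smul_measure, integral_add_measure (integrable_dirac (by simp))
    (integrable_dirac (by simp)), integral_dirac, integral_dirac,
    ENNReal.toReal_ofReal (by positivity), Complex.real_smul]
  push_cast
  rw [Complex.cos]
  ring_nf

/-- The characteristic function of `invSqMeasure` is quadratic on `[-2π, 2π]`, as a function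
of `|t|`. -/
lemma charFun_invSqMeasure {t : ℝ} (ht : |t| ≤ 2 * Real.pi) :
    charFun invSqMeasure t = ((t ^ 2 / 2 - Real.pi * |t| + Real.pi ^ 2 / 3 : ℝ) : ℂ) := by
  have hpi := Real.pi_pos
  have hx : |t| / (2 * Real.pi) ∈ Set.Icc (0 : ℝ) 1 :=
    ⟨by positivity, (div_le_one (by positivity)).mpr ht⟩
  have h := (hasSum_one_div_nat_pow_mul_cos one_ne_zero hx).mul_left 2
  refine (hasSum_charFun_invSqMeasure t).unique ?_
  rw [Complex.hasSum_ofReal]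
  have hcos (n : ℕ) : Real.cos (2 * Real.pi * n * (|t| / (2 * Real.pi))) = Real.cos (n * t) := by
    rw [← Real.cos_abs (n * t), abs_mul, Nat.abs_cast]
    congr 1
    field_simp
  simp only [hcos, mul_one] at h
  convert! h using 1
  simp only [Polynomial.bernoulli, Finset.sum_range_succ, Finset.sum_range_zero, bernoulli_zero,
    bernoulli_one, bernoulli_two, Polynomial.map_add, Polynomial.map_monomial,
    Polynomial.eval_add, Polynomial.eval_monomial, Polynomial.map_zero, Polynomial.eval_zero]
  norm_num [Nat.factorial]
  field_simp
  rw [← sq_abs t]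
  ring

lemma charFun_smul_measure (c : ENNReal) (μ : Measure ℝ) (t : ℝ) :
    charFun (c • μ) t = c.toReal * charFun μ t := by
  simp [charFun_apply, integral_smul_measure]

lemma charFun_add_measure (μ ν : Measure ℝ) [IsFiniteMeasure μ] [IsFiniteMeasure ν] (t : ℝ) :
    charFun (μ + ν) t = charFun μ t + charFun ν t := by
  simp only [charFun_apply_real]
  exact integral_add_measure (integrable_exp_ofReal_mul_I μ t) (integrable_exp_ofReal_mul_I ν t)

lemma isProbabilityMeasure_of_charFun_zero {μ : Measure ℝ} (h : charFun μ 0 = 1) :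
    IsProbabilityMeasure μ := by
  rw [charFun_zero] at h
  have h' : μ.real Set.univ = 1 := by exact_mod_cast h
  exact ⟨(ENNReal.toReal_eq_one_iff _).mp h'⟩

/-- Finite measures whose characteristic functions agree on `[-1, 1]` have the same
convolution with any finite measure whose characteristic function vanishes outside
`[-1, 1]`. -/
lemma conv_eq_conv_of_charFun {μ ν η : Measure ℝ} [IsFiniteMeasure μ] [IsFiniteMeasure ν]
    [IsFiniteMeasure η] (h : ∀ t, |t| ≤ 1 → charFun μ t = charFun ν t)
    (hη : ∀ t, 1 < |t| → charFun η t = 0) : Measure.conv μ η = Measure.conv ν η := by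
  refine Measure.ext_of_charFun (funext fun t ↦ ?_)
  rw [charFun_conv, charFun_conv]
  rcases le_or_gt |t| 1 with ht | ht
  · rw [h t ht]
  · rw [hη t ht, mul_zero, mul_zero]

/-- Non-uniqueness of convolution factors (Example 3.8): two distinct probability measures
on ℝ which convolve identically with every probability measure whose characteristic
function vanishes outside `[-1, 1]`. -/
theorem stmt13 :
    ∃ μ ν : Measure ℝ, IsProbabilityMeasure μ ∧ IsProbabilityMeasure ν ∧ μ ≠ ν ∧
      ∀ η : Measure ℝ, IsProbabilityMeasure η →
        (∀ t : ℝ, 1 < |t| →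
          ∫ x, Complex.exp (Complex.I * ((t * x : ℝ) : ℂ)) ∂η = 0) →
        Measure.conv μ η = Measure.conv ν η := by
  have hpi := Real.pi_gt_three
  let c : ENNReal := ENNReal.ofReal (3 / (4 * Real.pi ^ 2))
  let d : ENNReal := ENNReal.ofReal (Real.pi ^ 2 / 3)
  have hc : c ≠ ⊤ := ENNReal.ofReal_ne_top
  have hd : d ≠ ⊤ := ENNReal.ofReal_ne_top
  let μ₀ : Measure ℝ := (3 : ENNReal) • invSqMeasure + invSqMeasure.map (3 * ·)
  let ν₀ : Measure ℝ := (3 : ENNReal) • invSqMeasure.map (2 * ·) + d • Measure.dirac 0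
  have := invSqMeasure.smul_finite (c := 3) (by simp)
  have := (invSqMeasure.map (2 * ·)).smul_finite (c := 3) (by simp)
  have := (Measure.dirac (0 : ℝ)).smul_finite hd
  have := μ₀.smul_finite hc
  have := ν₀.smul_finite hc
  have hμ {t : ℝ} (ht : |t| ≤ 1) : charFun (c • μ₀) t =
      ((3 / (4 * Real.pi ^ 2) * (6 * t ^ 2 - 6 * Real.pi * |t| + 4 * Real.pi ^ 2 / 3) : ℝ) : ℂ) := by
    rw [charFun_smul_measure, charFun_add_measure, charFun_smul_measure, charFun_map_mul,
      charFun_invSqMeasure (by linarith),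
      charFun_invSqMeasure (by rw [abs_mul, abs_of_pos (three_pos : (0 : ℝ) < 3)]; linarith),
      ENNReal.toReal_ofReal (by positivity), abs_mul, abs_of_pos (three_pos : (0 : ℝ) < 3)]
    push_cast
    simp only [ENNReal.toReal_ofNat, Complex.ofReal_ofNat]
    ring
  have hν {t : ℝ} (ht : |t| ≤ 1) : charFun (c • ν₀) t =
      ((3 / (4 * Real.pi ^ 2) * (6 * t ^ 2 - 6 * Real.pi * |t| + 4 * Real.pi ^ 2 / 3) : ℝ) : ℂ) := by
    rw [charFun_smul_measure, charFun_add_measure, charFun_smul_measure, charFun_smul_measure,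
      charFun_map_mul, charFun_dirac,
      charFun_invSqMeasure (by rw [abs_mul, abs_of_pos (two_pos : (0 : ℝ) < 2)]; linarith),
      ENNReal.toReal_ofReal (by positivity), ENNReal.toReal_ofReal (by positivity),
      abs_mul, abs_of_pos (two_pos : (0 : ℝ) < 2)]
    push_cast
    simp only [ENNReal.toReal_ofNat, Complex.ofReal_ofNat, inner_zero_left, Complex.ofReal_zero,
      zero_mul, Complex.exp_zero]
    ring
  have hone : 3 / (4 * Real.pi ^ 2) *
      (6 * (0 : ℝ) ^ 2 - 6 * Real.pi * |0| + 4 * Real.pi ^ 2 / 3) = 1 := by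
    rw [abs_zero]; field_simp; norm_num
  have h0 : |(0 : ℝ)| ≤ 1 := by simp
  refine ⟨c • μ₀, c • ν₀, isProbabilityMeasure_of_charFun_zero ?_,
    isProbabilityMeasure_of_charFun_zero ?_, fun heq ↦ ?_, fun η _ hη ↦
      conv_eq_conv_of_charFun (fun t ht ↦ (hμ ht).trans (hν ht).symm) fun t ht ↦ ?_⟩
  · rw [hμ h0, hone, Complex.ofReal_one]
  · rw [hν h0, hone, Complex.ofReal_one]
  · have hμ0 : (c • μ₀) {0} = 0 := by
      have hpre : (fun x : ℝ ↦ 3 * x) ⁻¹' {0} = {0} := by ext; simp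
      simp [μ₀, Measure.map_apply (measurable_const_mul (3 : ℝ)) (measurableSet_singleton 0), hpre,
        invSqMeasure_singleton_zero]
    rw [heq] at hμ0
    have hc0 : c ≠ 0 := (ENNReal.ofReal_pos.mpr (by positivity)).ne'
    have hd0 : d ≠ 0 := (ENNReal.ofReal_pos.mpr (by positivity)).ne'
    simp [ν₀, hc0, hd0] at hμ0
  · rw [charFun_apply_real, ← hη t ht]
    push_cast
    simp only [mul_comm Complex.I]
end

section
/- (General Le Cam third lemma along a sequence.) For each n let P_{n,j}, j ∈ ℕ ∪ {0}, be probability measures on (Ω_n, 𝒜_n), let D be a Polish space with its Borel σ-algebra, and let T_n : Ω_n → D be measurable. Let L_{n,j} := dP_{n,j}/dP_{n,0} denote the Radon–Nikodym derivative of the P_{n,0}-absolutely continuous part of P_{n,j}. Assume: (i) for each j ∈ ℕ, the sequence (P_{n,j})_n is contiguous with respect to (P_{n,0})_n, i.e. for every sequence of measurable sets A_n, P_{n,0}(A_n) → 0 implies P_{n,j}(A_n) → 0; (ii) the law under P_{n,0} of the pair ((L_{n,j})_{j ∈ ℕ}, T_n) converges weakly on [0,∞)^ℕ × D to a probability measure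 μ_0. Then for every j ∈ ℕ the law of ((L_{n,i})_{i ∈ ℕ}, T_n) under P_{n,j} converges weakly to the probability measure μ_j which has density (x, d) ↦ x_j with respect to μ_0 (in particular ∫ x_j dμ_0(x, d) = 1). -/
open MeasureTheory ProbabilityTheory Filter Topology

/-- Two ordered finite measures integrate a function bounded by `C` to values that differ by at most
`C` times the difference of the total masses. -/
theorem abs_integral_sub_integral_le_of_le {α : Type*} [MeasurableSpace α] {ν ρ : Measure α}
    [IsFiniteMeasure ν] [IsFiniteMeasure ρ] (hle : ν ≤ ρ) {G : α → ℝ} (hG : Measurable G) {C : ℝ}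
    (hC : ∀ a, |G a| ≤ C) :
    |∫ a, G a ∂ρ - ∫ a, G a ∂ν| ≤ C * (ρ.real Set.univ - ν.real Set.univ) := by
  have hint : ∀ (m : Measure α) [IsFiniteMeasure m], Integrable G m := fun m _ =>
    Integrable.of_bound hG.aestronglyMeasurable C (Eventually.of_forall hC)
  have h1 : ∫ a, (C - G a) ∂ν ≤ ∫ a, (C - G a) ∂ρ :=
    integral_mono_measure hle
      (Eventually.of_forall fun a => sub_nonneg.2 (le_of_abs_le (hC a)))
      ((integrable_const C).sub (hint ρ))
  have h2 : ∫ a, (C + G a) ∂ν ≤ ∫ a, (C + G a) ∂ρ :=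
    integral_mono_measure hle
      (Eventually.of_forall fun a => by
        have := neg_le_of_abs_le (hC a)
        simp only [Pi.zero_apply]; linarith)
      ((integrable_const C).add (hint ρ))
  rw [integral_sub (integrable_const C) (hint ν), integral_sub (integrable_const C) (hint ρ)] at h1
  rw [integral_add (integrable_const C) (hint ν), integral_add (integrable_const C) (hint ρ)] at h2
  simp only [integral_const, smul_eq_mul] at h1 h2
  rw [abs_le]
  constructor <;> linarith

/-- Comparison of integrals under a probability measure `ρ` and under a sub-density `f` of `ρ`
with respect to `μ`. -/
theorem abs_integral_sub_integral_mul_le {α : Type*} [MeasurableSpace α] {μ ρ : Measure α}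
    [IsProbabilityMeasure ρ] {f : α → ℝ} (hf : Measurable f) (hf0 : ∀ a, 0 ≤ f a)
    (hle : μ.withDensity (fun a => ENNReal.ofReal (f a)) ≤ ρ) {G : α → ℝ} (hG : Measurable G)
    {C : ℝ} (hC : ∀ a, |G a| ≤ C) :
    |∫ a, G a ∂ρ - ∫ a, G a * f a ∂μ| ≤ C * (1 - ∫ a, f a ∂μ) := by
  have hfin : IsFiniteMeasure (μ.withDensity fun a => ENNReal.ofReal (f a)) :=
    isFiniteMeasure_of_le ρ hle
  have h := abs_integral_sub_integral_le_of_le hle hG hC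
  rw [integral_withDensity_eq_integral_toReal_smul hf.ennreal_ofReal
    (Eventually.of_forall fun _ => ENNReal.ofReal_lt_top)] at h
  have hmass : (μ.withDensity fun a => ENNReal.ofReal (f a)).real Set.univ = ∫ a, f a ∂μ := by
    rw [integral_eq_lintegral_of_nonneg_ae (Eventually.of_forall hf0) hf.aestronglyMeasurable,
      measureReal_def, withDensity_apply _ MeasurableSet.univ, Measure.restrict_univ]
  rw [hmass, probReal_univ] at h
  simpa [ENNReal.toReal_ofReal (hf0 _), mul_comm] using h

/-- Truncating the Radon-Nikodym derivative gives a sub-density. -/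
theorem withDensity_truncated_rnDeriv_le {α : Type*} [MeasurableSpace α] (μ ρ : Measure α)
    (K : ℝ) :
    μ.withDensity (fun a => ENNReal.ofReal (min (max (ρ.rnDeriv μ a).toReal 0) K)) ≤ ρ := by
  refine le_trans (withDensity_mono (Eventually.of_forall fun a => ?_))
    (Measure.withDensity_rnDeriv_le ρ μ)
  refine (ENNReal.ofReal_le_ofReal (min_le_left _ _)).trans ?_
  rw [max_eq_left ENNReal.toReal_nonneg]
  exact ENNReal.ofReal_toReal_le

/-- Outside a set of small `μ`-measure, `ρ` is dominated by the truncated Radon-Nikodym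
derivative. -/
theorem exists_measurableSet_measure_le_integral_truncated_rnDeriv {α : Type*} [MeasurableSpace α]
    (μ ρ : Measure α) [IsProbabilityMeasure μ] [IsProbabilityMeasure ρ] {K : ℝ} (hK : 0 < K) :
    ∃ A, MeasurableSet A ∧ μ A ≤ ENNReal.ofReal K⁻¹ ∧
      1 - ρ.real A ≤ ∫ a, min (max (ρ.rnDeriv μ a).toReal 0) K ∂μ := by
  obtain ⟨S, hS, hμS, hρS⟩ : ∃ S, MeasurableSet S ∧ μ S = 0 ∧ ρ.singularPart μ Sᶜ = 0 := by
    obtain ⟨s, hs, h1, h2⟩ := Measure.mutuallySingular_singularPart ρ μ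
    exact ⟨sᶜ, hs.compl, h2, by simpa using h1⟩
  let A := {a | ENNReal.ofReal K ≤ ρ.rnDeriv μ a} ∪ S
  have hAm : MeasurableSet A :=
    (measurableSet_le measurable_const (Measure.measurable_rnDeriv ρ μ)).union hS
  refine ⟨A, hAm, ?_, ?_⟩
  · refine (measure_union_le _ _).trans ?_
    rw [hμS, add_zero, ENNReal.ofReal_inv_of_pos hK]
    refine (meas_ge_le_lintegral_div (Measure.measurable_rnDeriv ρ μ).aemeasurable
      (by simpa using hK) ENNReal.ofReal_ne_top).trans ?_
    rw [← one_div]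
    gcongr
    exact (Measure.lintegral_rnDeriv_le).trans_eq measure_univ
  · have hm : Measurable fun a => min (max (ρ.rnDeriv μ a).toReal 0) K :=
      ((Measure.measurable_rnDeriv ρ μ).ennreal_toReal.max measurable_const).min measurable_const
    have hle : ρ Aᶜ ≤ ∫⁻ a, ENNReal.ofReal (min (max (ρ.rnDeriv μ a).toReal 0) K) ∂μ := by
      have hdec : ρ Aᶜ = ∫⁻ a in Aᶜ, ρ.rnDeriv μ a ∂μ := by
        conv_lhs => rw [Measure.haveLebesgueDecomposition_add ρ μ]
        rw [Measure.add_apply, withDensity_apply _ hAm.compl,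
          measure_mono_null (Set.compl_subset_compl.2 Set.subset_union_right) hρS, zero_add]
      rw [hdec]
      refine le_trans (setLIntegral_mono' hAm.compl fun a ha => ?_) (setLIntegral_le_lintegral Aᶜ _)
      have hlt : ρ.rnDeriv μ a < ENNReal.ofReal K := by
        by_contra h
        exact ha (Or.inl (not_lt.1 h))
      rw [max_eq_left ENNReal.toReal_nonneg, min_eq_left, ENNReal.ofReal_toReal hlt.ne_top]
      exact ENNReal.toReal_le_of_le_ofReal hK.le hlt.le
    have h0 (a : α) : 0 ≤ min (max (ρ.rnDeriv μ a).toReal 0) K := le_min (le_max_right _ _) hK.le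
    rw [integral_eq_lintegral_of_nonneg_ae (Eventually.of_forall h0) hm.aestronglyMeasurable,
      ← probReal_compl_eq_one_sub hAm]
    refine ENNReal.toReal_mono (ne_top_of_le_ne_top (measure_ne_top ρ Set.univ) ?_) hle
    have := withDensity_truncated_rnDeriv_le μ ρ K Set.univ
    rwa [withDensity_apply _ MeasurableSet.univ, Measure.restrict_univ] at this

/-- Under contiguity, the truncated likelihood ratios asymptotically retain nearly all mass. -/
theorem exists_eventually_lt_integral_truncated_rnDeriv {Ω : ℕ → Type*}
    [∀ n, MeasurableSpace (Ω n)] (Q P : (n : ℕ) → Measure (Ω n))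
    [∀ n, IsProbabilityMeasure (Q n)] [∀ n, IsProbabilityMeasure (P n)]
    (hcontig : ∀ A : (n : ℕ) → Set (Ω n), (∀ n, MeasurableSet (A n)) →
      Tendsto (fun n => Q n (A n)) atTop (𝓝 0) → Tendsto (fun n => P n (A n)) atTop (𝓝 0))
    {ε : ℝ} (hε : 0 < ε) :
    ∃ K : ℕ, ∀ᶠ n in atTop,
      1 - ε < ∫ ω, min (max ((P n).rnDeriv (Q n) ω).toReal 0) ((K : ℝ) + 1) ∂(Q n) := by
  by_contra hcon
  simp only [not_exists, not_eventually, not_lt] at hcon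
  obtain ⟨φ, hφ, hφP⟩ := extraction_forall_of_frequently hcon
  have hpos (k : ℕ) : (0 : ℝ) < k + 1 := by positivity
  choose A hAm hAQ hAP using fun n k : ℕ =>
    exists_measurableSet_measure_le_integral_truncated_rnDeriv (Q n) (P n) (hpos k)
  set B : (n : ℕ) → Set (Ω n) := fun n => ⋃ k, ⋃ _ : φ k = n, A n k with hB
  have hBφ (k : ℕ) : B (φ k) = A (φ k) k := by
    ext ω
    simp [hB, hφ.injective.eq_iff]
  have hBm (n : ℕ) : MeasurableSet (B n) :=
    MeasurableSet.iUnion fun k => MeasurableSet.iUnion fun _ => hAm n k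
  have hlim : Tendsto (fun k : ℕ => ENNReal.ofReal ((k : ℝ) + 1)⁻¹) atTop (𝓝 0) := by
    have h := tendsto_one_div_add_atTop_nhds_zero_nat (𝕜 := ℝ)
    simpa only [one_div, ENNReal.ofReal_zero] using ENNReal.tendsto_ofReal h
  have hBQ : Tendsto (fun n => Q n (B n)) atTop (𝓝 0) := by
    rw [ENNReal.tendsto_nhds_zero] at hlim ⊢
    intro δ hδ
    obtain ⟨k₀, hk₀⟩ := eventually_atTop.1 (hlim δ hδ)
    filter_upwards [eventually_ge_atTop (φ k₀)] with n hn
    by_cases h : ∃ k, φ k = n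
    · obtain ⟨k, rfl⟩ := h
      rw [hBφ]
      exact (hAQ _ _).trans (hk₀ k (hφ.le_iff_le.1 hn))
    · have : B n = ∅ := by
        simp only [hB, Set.iUnion_eq_empty]
        exact fun k hk => absurd ⟨k, hk⟩ h
      simp [this]
  have hBP := ((ENNReal.tendsto_toReal ENNReal.zero_ne_top).comp (hcontig B hBm hBQ)).comp
    hφ.tendsto_atTop
  obtain ⟨k, hk⟩ := (hBP.eventually_lt_const (by simpa using hε)).exists
  have h1 := hAP (φ k) k
  have h2 := hφP k
  simp only [Function.comp_apply, hBφ, ← measureReal_def] at hk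
  linarith

/-- General Le Cam third lemma along a sequence (Lemma 4.4): joint weak convergence of the
likelihood ratios and a statistic under the base measures, together with contiguity, yields
weak convergence under the alternatives, with the limit law having density `x_j` w.r.t. the
limit law under the base measures. -/
theorem stmt17 (Ω : ℕ → Type*) [∀ n, MeasurableSpace (Ω n)]
    (P0 : (n : ℕ) → Measure (Ω n)) (hP0 : ∀ n, IsProbabilityMeasure (P0 n))
    (P : (n : ℕ) → ℕ → Measure (Ω n)) (hP : ∀ n j, IsProbabilityMeasure (P n j))
    {D : Type*} [TopologicalSpace D] [PolishSpace D] [MeasurableSpace D] [BorelSpace D]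
    (T : (n : ℕ) → Ω n → D) (hT : ∀ n, Measurable (T n))
    -- (i) contiguity of `(P n j)ₙ` with respect to `(P0 n)ₙ` for every `j`
    (hcontig : ∀ j : ℕ, ∀ A : (n : ℕ) → Set (Ω n), (∀ n, MeasurableSet (A n)) →
      Tendsto (fun n => P0 n (A n)) atTop (𝓝 0) →
      Tendsto (fun n => P n j (A n)) atTop (𝓝 0))
    -- (ii) joint weak convergence of the likelihood ratios and `T n` under `P0 n`
    (μ₀ : Measure ((ℕ → ℝ) × D)) (hμ₀ : IsProbabilityMeasure μ₀)
    (hconv : ∀ g : BoundedContinuousFunction ((ℕ → ℝ) × D) ℝ,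
      Tendsto (fun n => ∫ ω,
          g (fun j => (((P n j).rnDeriv (P0 n)) ω).toReal, T n ω) ∂(P0 n))
        atTop (𝓝 (∫ p, g p ∂μ₀))) :
    ∀ j : ℕ,
      (∀ g : BoundedContinuousFunction ((ℕ → ℝ) × D) ℝ,
        Tendsto (fun n => ∫ ω,
            g (fun i => (((P n i).rnDeriv (P0 n)) ω).toReal, T n ω) ∂(P n j))
          atTop
          (𝓝 (∫ p, g p ∂(μ₀.withDensity fun p => ENNReal.ofReal (p.1 j)))))
      ∧ ∫⁻ p, ENNReal.ofReal (p.1 j) ∂μ₀ = 1 := by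
  intro j
  have hX (n : ℕ) : Measurable
      fun ω => ((fun i => (((P n i).rnDeriv (P0 n)) ω).toReal, T n ω) : (ℕ → ℝ) × D) :=
    (measurable_pi_lambda _ fun i =>
      (Measure.measurable_rnDeriv _ _).ennreal_toReal).prodMk (hT n)
  have hK0 (K : ℕ) : (0 : ℝ) ≤ K + 1 := by positivity
  have hccont (K : ℕ) :
      Continuous fun p : (ℕ → ℝ) × D => min (max (p.1 j) 0) ((K : ℝ) + 1) := by fun_prop
  have hc0 (K : ℕ) (p : (ℕ → ℝ) × D) : 0 ≤ min (max (p.1 j) 0) ((K : ℝ) + 1) :=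
    le_min (le_max_right _ _) (hK0 K)
  let c (K : ℕ) : BoundedContinuousFunction ((ℕ → ℝ) × D) ℝ :=
    BoundedContinuousFunction.ofNormedAddCommGroup _ (hccont K) (K + 1) fun p => by
      rw [Real.norm_of_nonneg (hc0 K p)]
      exact min_le_right _ _
  have hcapp (K : ℕ) (p : (ℕ → ℝ) × D) : c K p = min (max (p.1 j) 0) ((K : ℝ) + 1) := rfl
  -- bounds for each `n`
  have hbound (n K : ℕ) (g : BoundedContinuousFunction ((ℕ → ℝ) × D) ℝ) :=
    abs_integral_sub_integral_mul_le (μ := P0 n) (ρ := P n j)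
      (f := fun ω => c K (fun i => (((P n i).rnDeriv (P0 n)) ω).toReal, T n ω))
      ((c K).continuous.measurable.comp (hX n)) (fun _ => hc0 K _)
      (withDensity_truncated_rnDeriv_le (P0 n) (P n j) (K + 1))
      (g.continuous.measurable.comp (hX n)) (fun ω => g.norm_coe_le_norm _)
  have hle1 (n K : ℕ) :
      ∫ ω, c K (fun i => (((P n i).rnDeriv (P0 n)) ω).toReal, T n ω) ∂(P0 n) ≤ 1 := by
    have h := hbound n K (BoundedContinuousFunction.const _ 1)
    have : Nonempty D := (nonempty_of_isProbabilityMeasure μ₀).map Prod.snd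
    simp only [BoundedContinuousFunction.norm_const_eq, norm_one, one_mul] at h
    linarith [(abs_nonneg _).trans h]
  have ha1 (K : ℕ) : ∫ p, c K p ∂μ₀ ≤ 1 :=
    le_of_tendsto' (hconv (c K)) fun n => hle1 n K
  have haε (ε : ℝ) (hε : 0 < ε) : ∃ K : ℕ, 1 - ε ≤ ∫ p, c K p ∂μ₀ := by
    obtain ⟨K, hK⟩ := exists_eventually_lt_integral_truncated_rnDeriv P0 (fun n => P n j)
      (hcontig j) hε
    exact ⟨K, ge_of_tendsto (hconv (c K)) (hK.mono fun n hn => hn.le)⟩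
  have hcint (K : ℕ) :
      ∫⁻ p, ENNReal.ofReal (c K p) ∂μ₀ = ENNReal.ofReal (∫ p, c K p ∂μ₀) :=
    (ofReal_integral_eq_lintegral_ofReal ((c K).integrable μ₀)
      (Eventually.of_forall (hc0 K))).symm
  have hcle (K : ℕ) (p : (ℕ → ℝ) × D) :
      ENNReal.ofReal (c K p) ≤ ENNReal.ofReal (p.1 j) := by
    rw [hcapp]
    refine (ENNReal.ofReal_le_ofReal (min_le_left _ _)).trans ?_
    simp [ENNReal.ofReal_max]
  have hmean : ∫⁻ p, ENNReal.ofReal (p.1 j) ∂μ₀ = 1 := by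
    apply le_antisymm
    · have hsup (p : (ℕ → ℝ) × D) :
          Tendsto (fun K : ℕ => ENNReal.ofReal (c K p)) atTop
            (𝓝 (ENNReal.ofReal (p.1 j))) := by
        obtain ⟨N, hN⟩ := exists_nat_ge (max (p.1 j) 0)
        refine tendsto_const_nhds.congr' ?_
        filter_upwards [eventually_ge_atTop N] with K hK
        have : (N : ℝ) ≤ K := by exact_mod_cast hK
        rw [hcapp, min_eq_left (by linarith), ENNReal.ofReal_max]
        simp
      have hmono (p : (ℕ → ℝ) × D) : Monotone fun K : ℕ => ENNReal.ofReal (c K p) := by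
        intro K K' h
        simp only [hcapp]
        gcongr
      refine le_of_tendsto' (lintegral_tendsto_of_tendsto_of_monotone
        (fun K => (c K).continuous.measurable.ennreal_ofReal.aemeasurable)
        (Eventually.of_forall hmono) (Eventually.of_forall hsup)) fun K => ?_
      rw [hcint]
      simpa using ha1 K
    · refine le_of_forall_lt fun b hb => ?_
      have hb' : b.toReal < 1 := by
        simpa using (ENNReal.toReal_lt_toReal hb.ne_top ENNReal.one_ne_top).2 hb
      obtain ⟨K, hK⟩ := haε ((1 - b.toReal) / 2) (by linarith)
      calc b < ENNReal.ofReal (∫ p, c K p ∂μ₀) :=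
            (ENNReal.lt_ofReal_iff_toReal_lt hb.ne_top).2 (by linarith)
        _ ≤ _ := by
            rw [← hcint]
            exact lintegral_mono (hcle K)
  refine ⟨fun g => ?_, hmean⟩
  have hρ : IsProbabilityMeasure (μ₀.withDensity fun p => ENNReal.ofReal (p.1 j)) :=
    ⟨by rwa [withDensity_apply _ MeasurableSet.univ, Measure.restrict_univ]⟩
  have hlimbound (K : ℕ) := abs_integral_sub_integral_mul_le (μ := μ₀)
    (ρ := μ₀.withDensity fun p => ENNReal.ofReal (p.1 j)) (f := c K)
    (c K).continuous.measurable (hc0 K)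
    (withDensity_mono (Eventually.of_forall (hcle K))) g.continuous.measurable
    (fun p => g.norm_coe_le_norm p)
  rw [Metric.tendsto_atTop']
  intro ε hε
  obtain ⟨K, hK⟩ := haε (ε / (4 * (‖g‖ + 1))) (by positivity)
  have hsmall : ‖g‖ * (1 - ∫ p, c K p ∂μ₀) < ε / 3 := by
    have h1 : ‖g‖ * (1 - ∫ p, c K p ∂μ₀) ≤ (‖g‖ + 1) * (ε / (4 * (‖g‖ + 1))) :=
      mul_le_mul (by linarith) (by linarith) (by linarith [ha1 K]) (by positivity)
    have h2 : (‖g‖ + 1) * (ε / (4 * (‖g‖ + 1))) = ε / 4 := by field_simp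
    linarith
  have hev1 := (((hconv (c K)).const_sub 1).const_mul ‖g‖).eventually_lt_const hsmall
  have hev2 := Metric.tendsto_nhds.1 (hconv (g * c K)) (ε / 3) (by positivity)
  refine (eventually_atTop.1 (hev1.and hev2)).imp fun N hN n hn => ?_
  obtain ⟨h1, h2⟩ := hN n hn.le
  have h3 := hbound n K g
  have h4 := hlimbound K
  simp only [Real.dist_eq, BoundedContinuousFunction.mul_apply] at h2 ⊢
  rw [abs_lt] at h2 ⊢
  rw [abs_le] at h3 h4
  simp only [Function.comp_def] at h3
  constructor <;> linarith [h3.1, h3.2, h4.1, h4.2, h2.1, h2.2]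
end

section
/- Let θ = (θ₁, θ₂) ∈ ℝ² and for n large enough that 1 + (θ₂ − θ₁)/n > 0 let U_1, …, U_n be i.i.d. uniform on [0,1] and set Z_{n,i} := (1 + (θ₂ − θ₁)/n)·U_i + θ₁/n, with Z_{1:n} := min_i Z_{n,i} and Z_{n:n} := max_i Z_{n,i}. Let X₁, X₂ be independent standard exponential random variables (density e^{−x} on [0, ∞)). Then the law of the pair (n·Z_{1:n}, n·(Z_{n:n} − 1)) converges to the law of (X₁ + θ₁, −X₂ + θ₂) in total variation: the total variation distance between the two laws on ℝ² tends to 0 as n → ∞. -/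
open MeasureTheory Filter Topology

/-- The standard exponential distribution on ℝ (density `e^{-x}` on `[0, ∞)`). -/
noncomputable def expM : Measure ℝ :=
  volume.withDensity fun x => ENNReal.ofReal (if 0 ≤ x then Real.exp (-x) else 0)

/-- Lebesgue measure on the open positive quadrant. -/
noncomputable def quadrant : Measure (ℝ × ℝ) :=
  (volume.restrict (Set.Ioi (0:ℝ))).prod (volume.restrict (Set.Ioi (0:ℝ)))

/-- The joint density of the pair `(N * min U, N * (1 - max U))` for a uniform sample of
size `k + 2`. -/
noncomputable def extremesDensity (k : ℕ) (N : ℝ) (p : ℝ × ℝ) : ℝ :=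
  ((k:ℝ) + 2) * (k + 1) / N ^ 2 * max (1 - (p.1 + p.2) / N) 0 ^ k

lemma hasDerivAt_max_zero_pow {k : ℕ} (hk : 1 ≤ k) (x : ℝ) :
    HasDerivAt (fun y : ℝ => max y 0 ^ (k + 1)) ((k + 1) * max x 0 ^ k) x := by
  refine hasDerivAt_of_hasDerivAt_of_ne' (x := 0) (g := fun x : ℝ => ((k:ℝ) + 1) * max x 0 ^ k)
    ?_ (by fun_prop) (by fun_prop) x
  intro y hy
  rcases lt_or_gt_of_ne hy with h | h
  · have h0 : ((k:ℝ) + 1) * max y 0 ^ k = 0 := by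
      rw [max_eq_right h.le, zero_pow (by omega), mul_zero]
    rw [h0]
    refine (hasDerivAt_const y (0:ℝ)).congr_of_eventuallyEq ?_
    filter_upwards [Iio_mem_nhds h] with z hz
    rw [max_eq_right (le_of_lt hz), zero_pow (by omega)]
  · have h0 := hasDerivAt_pow (k + 1) y
    rw [max_eq_left h.le]
    refine (h0.congr_of_eventuallyEq ?_).congr_deriv (by push_cast; simp)
    filter_upwards [Ioi_mem_nhds h] with z hz
    rw [max_eq_left (le_of_lt hz)]

lemma lintegral_Ioi_max_zero_pow {k : ℕ} (hk : 1 ≤ k) {N : ℝ} (hN : 0 < N) (c s : ℝ) :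
    ∫⁻ a in Set.Ioi s, ENNReal.ofReal ((k + 1) / N * max (1 - (a + c) / N) 0 ^ k)
      = ENNReal.ofReal (max (1 - (s + c) / N) 0 ^ (k + 1)) := by
  have hderiv : ∀ x ∈ Set.Ici s, HasDerivAt (fun a => - max (1 - (a + c) / N) 0 ^ (k + 1))
      ((k + 1) / N * max (1 - (x + c) / N) 0 ^ k) x := by
    intro x _
    have h1 : HasDerivAt (fun a : ℝ => 1 - (a + c) / N) (-(1 / N)) x :=
      (((hasDerivAt_id x).add_const c).div_const N).const_sub 1
    have h2 := ((hasDerivAt_max_zero_pow hk (1 - (x + c) / N)).comp x h1).neg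
    refine h2.congr_deriv (by ring)
  have hpos : ∀ x ∈ Set.Ioi s, 0 ≤ ((k:ℝ) + 1) / N * max (1 - (x + c) / N) 0 ^ k := by
    intro x _; positivity
  have hlim : Tendsto (fun a => - max (1 - (a + c) / N) 0 ^ (k + 1)) atTop (𝓝 0) := by
    refine tendsto_const_nhds.congr' ?_
    filter_upwards [eventually_ge_atTop (N - c)] with a ha
    have : 1 - (a + c) / N ≤ 0 := by
      rw [sub_nonpos, le_div_iff₀ hN]; linarith
    rw [max_eq_right this, zero_pow (by omega), neg_zero]
  rw [← ofReal_integral_eq_lintegral_ofReal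
    (integrableOn_Ioi_deriv_of_nonneg' hderiv hpos hlim)
    (ae_restrict_of_forall_mem measurableSet_Ioi hpos),
    integral_Ioi_of_hasDerivAt_of_nonneg' hderiv hpos hlim]
  simp

lemma extremesDensity_nonneg (k : ℕ) (N : ℝ) (p : ℝ × ℝ) : 0 ≤ extremesDensity k N p := by
  unfold extremesDensity; positivity

@[fun_prop]
lemma continuous_extremesDensity (k : ℕ) (N : ℝ) : Continuous (extremesDensity k N) := by
  unfold extremesDensity; fun_prop

lemma withDensity_extremesDensity_Ioi_prod {k : ℕ} (hk : 1 ≤ k) {N : ℝ} (hN : 0 < N) (s t : ℝ) :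
    quadrant.withDensity (fun p => ENNReal.ofReal (extremesDensity k N p))
        (Set.Ioi s ×ˢ Set.Ioi t)
      = ENNReal.ofReal (max (1 - (max s 0 + max t 0) / N) 0 ^ (k + 2)) := by
  rw [withDensity_apply _ (measurableSet_Ioi.prod measurableSet_Ioi), quadrant,
    Measure.prod_restrict, Measure.restrict_restrict (measurableSet_Ioi.prod measurableSet_Ioi),
    Set.prod_inter_prod, Set.Ioi_inter_Ioi, Set.Ioi_inter_Ioi, ← Measure.prod_restrict,
    lintegral_prod _ (by fun_prop)]
  have key : ∀ a : ℝ, ∫⁻ b in Set.Ioi (max t 0), ENNReal.ofReal (extremesDensity k N (a, b))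
      = ENNReal.ofReal (((k + 1 : ℕ) + 1) / N * max (1 - (a + max t 0) / N) 0 ^ (k + 1)) := by
    intro a
    have h : ∀ b : ℝ, ENNReal.ofReal (extremesDensity k N (a, b))
        = ENNReal.ofReal (((k:ℝ) + 2) / N)
          * ENNReal.ofReal ((k + 1) / N * max (1 - (b + a) / N) 0 ^ k) := by
      intro b
      rw [← ENNReal.ofReal_mul (by positivity), extremesDensity, add_comm b a]
      congr 1
      ring
    simp_rw [h]
    rw [lintegral_const_mul _ (by fun_prop), lintegral_Ioi_max_zero_pow hk hN,
      ← ENNReal.ofReal_mul (by positivity), add_comm a]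
    congr 3
    push_cast; ring
  simp_rw [key]
  exact lintegral_Ioi_max_zero_pow (by omega) hN _ _

lemma volume_restrict_Icc_Ioo {N : ℝ} (hN : 0 < N) (s t : ℝ) :
    volume.restrict (Set.Icc (0:ℝ) 1) (Set.Ioo (s / N) (1 - t / N))
      = ENNReal.ofReal (max (1 - (max s 0 + max t 0) / N) 0) := by
  rw [Measure.restrict_apply measurableSet_Ioo,
    measure_congr (Ioo_ae_eq_Icc.inter (ae_eq_refl (Set.Icc (0:ℝ) 1))), Set.Icc_inter_Icc,
    Real.volume_Icc, ENNReal.ofReal_max, ENNReal.ofReal_zero, max_eq_left (zero_le (a := ENNReal.ofReal _))]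
  congr 1
  have h1 : s / N ⊔ 0 = max s 0 / N := by
    rw [← max_div_div_right hN.le s 0, zero_div]
  have h2 : (1 - t / N) ⊓ 1 = 1 - max t 0 / N := by
    rw [← max_div_div_right hN.le t 0, zero_div]
    rcases le_total (t / N) 0 with h | h
    · rw [max_eq_right h, inf_eq_right.2 (by linarith), sub_zero]
    · rw [max_eq_left h, inf_eq_left.2 (by linarith)]
  rw [h1, h2]
  ring

instance : IsProbabilityMeasure (volume.restrict (Set.Icc (0:ℝ) 1)) := ⟨by simp⟩

lemma MeasureTheory.Measure.ext_of_Ioi_prod {μ ν : Measure (ℝ × ℝ)} [IsFiniteMeasure μ]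
    (h : ∀ s t : ℝ, μ (Set.Ioi s ×ˢ Set.Ioi t) = ν (Set.Ioi s ×ˢ Set.Ioi t)) : μ = ν := by
  have hcov : ⋃ i : ℕ, Set.Ioi (-(i:ℝ)) = Set.univ := by
    refine Set.eq_univ_of_forall fun x => Set.mem_iUnion.2 ?_
    obtain ⟨i, hi⟩ := exists_nat_gt (-x)
    exact ⟨i, by simp only [Set.mem_Ioi]; linarith⟩
  have hspan : IsCountablySpanning (Set.range (Set.Ioi : ℝ → Set ℝ)) :=
    ⟨fun i : ℕ => Set.Ioi (-(i:ℝ)), fun i => ⟨_, rfl⟩, hcov⟩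
  have hgen : MeasurableSpace.generateFrom (Set.range (Set.Ioi : ℝ → Set ℝ))
      = (inferInstance : MeasurableSpace ℝ) := by
    rw [← borel_eq_generateFrom_Ioi, BorelSpace.measurable_eq (α := ℝ)]
  have hpi : IsPiSystem (Set.range (Set.Ioi : ℝ → Set ℝ)) := isPiSystem_Ioi
  refine Measure.ext_of_generateFrom_of_iUnion
    (Set.image2 (· ×ˢ ·) (Set.range (Set.Ioi : ℝ → Set ℝ)) (Set.range Set.Ioi))
    (fun i : ℕ => Set.Ioi (-(i:ℝ)) ×ˢ Set.Ioi (-(i:ℝ)))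
    (generateFrom_eq_prod hgen hgen hspan hspan).symm (hpi.prod hpi) ?_
    (fun i => ⟨_, ⟨_, rfl⟩, _, ⟨_, rfl⟩, rfl⟩) (fun i => measure_ne_top _ _) ?_
  · refine Set.eq_univ_of_forall fun x => Set.mem_iUnion.2 ?_
    obtain ⟨i, hi⟩ := exists_nat_gt (max (-x.1) (-x.2))
    rw [max_lt_iff] at hi
    exact ⟨i, by simp only [Set.mem_Ioi]; linarith, by simp only [Set.mem_Ioi]; linarith⟩
  · rintro _ ⟨_, ⟨s, rfl⟩, _, ⟨t, rfl⟩, rfl⟩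
    exact h s t

lemma map_extremes_eq_withDensity (θ₁ θ₂ : ℝ) {k : ℕ} (hk : 1 ≤ k)
    (hN : 0 < ((k + 2 : ℕ) : ℝ) + (θ₂ - θ₁)) :
    (Measure.pi fun _ : Fin (k + 2) => volume.restrict (Set.Icc (0:ℝ) 1)).map
        (fun u : Fin (k + 2) → ℝ =>
          (((k + 2 : ℕ) : ℝ) * (⨅ i, ((1 + (θ₂ - θ₁) / (k + 2 : ℕ)) * u i + θ₁ / (k + 2 : ℕ)))
            - θ₁,
          θ₂ - ((k + 2 : ℕ) : ℝ)
            * ((⨆ i, ((1 + (θ₂ - θ₁) / (k + 2 : ℕ)) * u i + θ₁ / (k + 2 : ℕ))) - 1)))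
      = quadrant.withDensity
        (fun p => ENNReal.ofReal (extremesDensity k ((k + 2 : ℕ) + (θ₂ - θ₁)) p)) := by
  have hn : 0 < ((k + 2 : ℕ) : ℝ) := by positivity
  generalize hNdef : ((k + 2 : ℕ) : ℝ) + (θ₂ - θ₁) = N at hN ⊢
  have hm : Measurable (fun u : Fin (k + 2) → ℝ =>
          (((k + 2 : ℕ) : ℝ) * (⨅ i, ((1 + (θ₂ - θ₁) / (k + 2 : ℕ)) * u i + θ₁ / (k + 2 : ℕ)))
            - θ₁,
          θ₂ - ((k + 2 : ℕ) : ℝ)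
            * ((⨆ i, ((1 + (θ₂ - θ₁) / (k + 2 : ℕ)) * u i + θ₁ / (k + 2 : ℕ))) - 1))) := by
    refine Measurable.prodMk ?_ ?_
    · exact ((Measurable.iInf fun i => by fun_prop).const_mul _).sub_const _
    · exact (((Measurable.iSup fun i => by fun_prop).sub_const _).const_mul _).const_sub _
  have := Measure.isProbabilityMeasure_map (μ := Measure.pi fun _ : Fin (k + 2) =>
    volume.restrict (Set.Icc (0:ℝ) 1)) hm.aemeasurable
  refine Measure.ext_of_Ioi_prod fun s t => ?_
  rw [withDensity_extremesDensity_Ioi_prod hk hN,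
    Measure.map_apply hm (measurableSet_Ioi.prod measurableSet_Ioi)]
  have hset : (fun u : Fin (k + 2) → ℝ =>
          (((k + 2 : ℕ) : ℝ) * (⨅ i, ((1 + (θ₂ - θ₁) / (k + 2 : ℕ)) * u i + θ₁ / (k + 2 : ℕ)))
            - θ₁,
          θ₂ - ((k + 2 : ℕ) : ℝ)
            * ((⨆ i, ((1 + (θ₂ - θ₁) / (k + 2 : ℕ)) * u i + θ₁ / (k + 2 : ℕ))) - 1)))
        ⁻¹' (Set.Ioi s ×ˢ Set.Ioi t)
      = Set.univ.pi fun _ => Set.Ioo (s / N) (1 - t / N) := by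
    ext u
    have hZ : ∀ i, ((k + 2 : ℕ) : ℝ) *
        ((1 + (θ₂ - θ₁) / (k + 2 : ℕ)) * u i + θ₁ / (k + 2 : ℕ)) = N * u i + θ₁ := by
      intro i; rw [← hNdef]; field_simp
    generalize hz : (fun i => (1 + (θ₂ - θ₁) / (k + 2 : ℕ)) * u i + θ₁ / (k + 2 : ℕ)) = Z
    have hZ' : ∀ i, ((k + 2 : ℕ) : ℝ) * Z i = N * u i + θ₁ := by
      intro i; rw [← hz]; exact hZ i
    simp only [Set.mem_preimage, Set.mem_prod, Set.mem_Ioi, Set.mem_univ_pi, Set.mem_Ioo, hz,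
      forall_and, div_lt_iff₀ hN]
    refine and_congr ?_ ?_
    · constructor
      · intro h i
        have := mul_le_mul_of_nonneg_left (ciInf_le (Set.finite_range Z).bddBelow i) hn.le
        rw [hZ'] at this
        linarith
      · intro h
        obtain ⟨i, hi⟩ := exists_eq_ciInf_of_finite (f := Z)
        rw [← hi, hZ']
        linarith [h i]
    · have hlt : ∀ x, x < 1 - t / N ↔ t < N - N * x := by
        intro x
        rw [lt_sub_comm, div_lt_iff₀ hN]
        constructor <;> intro <;> linarith
      simp only [hlt]
      constructor
      · intro h i
        have := mul_le_mul_of_nonneg_left (le_ciSup (Set.finite_range Z).bddAbove i) hn.le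
        rw [hZ'] at this
        linarith
      · intro h
        obtain ⟨i, hi⟩ := exists_eq_ciSup_of_finite (f := Z)
        rw [← hi, mul_sub, hZ']
        linarith [h i]
  rw [hset, Measure.pi_pi]
  simp only [volume_restrict_Icc_Ioo hN, Finset.prod_const, Finset.card_univ, Fintype.card_fin]
  rw [ENNReal.ofReal_pow (le_max_right _ _)]

lemma expM_prod_expM : expM.prod expM
    = quadrant.withDensity (fun p => ENNReal.ofReal (Real.exp (-p.1) * Real.exp (-p.2))) := by
  have h : expM = (volume.restrict (Set.Ioi (0:ℝ))).withDensity
      (fun x => ENNReal.ofReal (Real.exp (-x))) := by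
    rw [expM, restrict_Ioi_eq_restrict_Ici, ← withDensity_indicator measurableSet_Ici]
    congr 1
    ext x
    by_cases hx : 0 ≤ x <;> simp [hx]
  rw [h, quadrant, prod_withDensity (by fun_prop) (by fun_prop)]
  congr 1
  ext p
  rw [ENNReal.ofReal_mul (Real.exp_nonneg _)]

lemma abs_withDensity_sub_withDensity_le {α : Type*} [MeasurableSpace α] {μ : Measure α}
    {f g : α → ℝ} (hf : Integrable f μ) (hg : Integrable g μ) (hf0 : ∀ x, 0 ≤ f x)
    (hg0 : ∀ x, 0 ≤ g x) {A : Set α} (hA : MeasurableSet A) :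
    |(μ.withDensity (fun x => ENNReal.ofReal (f x)) A).toReal
      - (μ.withDensity (fun x => ENNReal.ofReal (g x)) A).toReal| ≤ ∫ x, ‖f x - g x‖ ∂μ := by
  rw [withDensity_apply _ hA, withDensity_apply _ hA,
    ← integral_eq_lintegral_of_nonneg_ae (ae_of_all _ hf0) hf.1.restrict,
    ← integral_eq_lintegral_of_nonneg_ae (ae_of_all _ hg0) hg.1.restrict,
    ← integral_sub hf.integrableOn hg.integrableOn]
  exact (norm_integral_le_integral_norm _).trans
    (setIntegral_le_integral (hf.sub hg).norm (ae_of_all _ fun _ => norm_nonneg _))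

lemma integrable_exp_mul_exp_quadrant {b : ℝ} (hb : 0 < b) :
    Integrable (fun p : ℝ × ℝ => Real.exp (-b * p.1) * Real.exp (-b * p.2)) quadrant :=
  (exp_neg_integrableOn_Ioi 0 hb).mul_prod (exp_neg_integrableOn_Ioi 0 hb)

lemma tendsto_extremesDensity (δ : ℝ) (p : ℝ × ℝ) :
    Tendsto (fun k : ℕ => extremesDensity k (((k + 2 : ℕ) : ℝ) + δ) p) atTop
      (𝓝 (Real.exp (-p.1) * Real.exp (-p.2))) := by
  have hcast : Tendsto (fun k : ℕ => (k:ℝ)) atTop atTop := tendsto_natCast_atTop_atTop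
  have hinv : Tendsto (fun k : ℕ => ((k:ℝ))⁻¹) atTop (𝓝 0) := tendsto_inv_atTop_zero.comp hcast
  have hratio : Tendsto (fun k : ℕ => (k:ℝ) / (((k + 2 : ℕ) : ℝ) + δ)) atTop (𝓝 1) := by
    have h : Tendsto (fun k : ℕ => (1 + (2 + δ) * (k:ℝ)⁻¹)⁻¹) atTop (𝓝 1) := by
      simpa using ((hinv.const_mul (2 + δ)).const_add 1).inv₀ (by simp)
    refine h.congr' ?_
    filter_upwards [eventually_gt_atTop 0] with k hk
    have : (k:ℝ) ≠ 0 := by positivity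
    rw [← inv_div, inv_inj]
    push_cast
    field_simp
    ring
  have hconst : Tendsto (fun k : ℕ => ((k:ℝ) + 2) * (k + 1) / (((k + 2 : ℕ) : ℝ) + δ) ^ 2)
      atTop (𝓝 1) := by
    have h : Tendsto (fun k : ℕ => (1 + 2 * (k:ℝ)⁻¹) * (1 + (k:ℝ)⁻¹)
        * ((k:ℝ) / (((k + 2 : ℕ) : ℝ) + δ)) ^ 2) atTop (𝓝 1) := by
      simpa using (((hinv.const_mul 2).const_add 1).mul (hinv.const_add 1)).mul (hratio.pow 2)
    refine h.congr' ?_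
    filter_upwards [eventually_gt_atTop 0] with k hk
    have : (k:ℝ) ≠ 0 := by positivity
    rw [div_pow]
    field_simp
  have hpow : Tendsto (fun k : ℕ => (1 + -((p.1 + p.2) / (((k + 2 : ℕ) : ℝ) + δ))) ^ k) atTop
      (𝓝 (Real.exp (-(p.1 + p.2)))) := by
    refine Real.tendsto_one_add_pow_exp_of_tendsto ?_
    have := hratio.const_mul (-(p.1 + p.2))
    rw [mul_one] at this
    exact this.congr fun k => by ring
  rw [← Real.exp_add, ← neg_add, ← one_mul (Real.exp _)]
  refine hconst.mul (hpow.congr' ?_)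
  filter_upwards [hcast.eventually_gt_atTop (-δ), hcast.eventually_ge_atTop (p.1 + p.2 - δ)]
    with k h1 h2
  have hN : 0 < ((k + 2 : ℕ) : ℝ) + δ := by push_cast; linarith
  rw [← sub_eq_add_neg, max_eq_left]
  rw [sub_nonneg, div_le_one hN]
  push_cast; linarith

lemma extremesDensity_le {k : ℕ} {δ : ℝ} (hk : 2 * |δ| + 2 ≤ k) {p : ℝ × ℝ}
    (h1 : 0 ≤ p.1) (h2 : 0 ≤ p.2) :
    extremesDensity k (((k + 2 : ℕ) : ℝ) + δ) p
      ≤ 4 * (Real.exp (-(1 / 2) * p.1) * Real.exp (-(1 / 2) * p.2)) := by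
  have hδ := neg_abs_le δ
  have hδ' := le_abs_self δ
  have hδ0 := abs_nonneg δ
  have hN : ((k:ℝ) + 2) / 2 ≤ ((k + 2 : ℕ) : ℝ) + δ := by push_cast; linarith
  have hN' : ((k + 2 : ℕ) : ℝ) + δ ≤ 2 * k := by push_cast; linarith
  generalize ((k + 2 : ℕ) : ℝ) + δ = N at hN hN' ⊢
  have hk0 : (0:ℝ) ≤ k := by positivity
  have hN0 : 0 < N := by linarith
  unfold extremesDensity
  refine mul_le_mul ?_ ?_ (by positivity) (by norm_num)
  · rw [div_le_iff₀ (by positivity)]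
    nlinarith
  · have hmax : max (1 - (p.1 + p.2) / N) 0 ≤ Real.exp (-((p.1 + p.2) / N)) :=
      max_le (Real.one_sub_le_exp_neg _) (Real.exp_nonneg _)
    refine (pow_le_pow_left₀ (le_max_right _ _) hmax k).trans ?_
    rw [← Real.exp_nat_mul, ← Real.exp_add, Real.exp_le_exp]
    have : (1 / 2) * (p.1 + p.2) ≤ k * ((p.1 + p.2) / N) := by
      rw [mul_div_assoc', le_div_iff₀ hN0]
      nlinarith
    linarith

lemma ae_quadrant_nonneg : ∀ᵐ p ∂quadrant, 0 ≤ p.1 ∧ 0 ≤ p.2 := by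
  rw [quadrant, Measure.prod_restrict]
  filter_upwards [ae_restrict_mem (measurableSet_Ioi.prod measurableSet_Ioi)] with p hp
  exact ⟨le_of_lt hp.1, le_of_lt hp.2⟩

lemma integrable_extremesDensity {k : ℕ} {δ : ℝ} (hk : 2 * |δ| + 2 ≤ k) :
    Integrable (extremesDensity k (((k + 2 : ℕ) : ℝ) + δ)) quadrant := by
  refine ((integrable_exp_mul_exp_quadrant (b := 1 / 2) (by norm_num)).const_mul 4).mono'
    (continuous_extremesDensity _ _).aestronglyMeasurable ?_
  filter_upwards [ae_quadrant_nonneg] with p hp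
  rw [Real.norm_of_nonneg (extremesDensity_nonneg _ _ _)]
  exact extremesDensity_le hk hp.1 hp.2

lemma integrable_exp_neg_mul_exp_neg_quadrant :
    Integrable (fun p : ℝ × ℝ => Real.exp (-p.1) * Real.exp (-p.2)) quadrant := by
  simpa using integrable_exp_mul_exp_quadrant one_pos

lemma tendsto_integral_norm_extremesDensity_sub (δ : ℝ) :
    Tendsto (fun k : ℕ => ∫ p, ‖extremesDensity k (((k + 2 : ℕ) : ℝ) + δ) p
      - Real.exp (-p.1) * Real.exp (-p.2)‖ ∂quadrant) atTop (𝓝 0) := by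
  rw [← integral_zero (ℝ × ℝ) ℝ (μ := quadrant)]
  refine tendsto_integral_filter_of_dominated_convergence
    (fun p => 4 * (Real.exp (-(1 / 2) * p.1) * Real.exp (-(1 / 2) * p.2))
      + Real.exp (-p.1) * Real.exp (-p.2)) ?_ ?_ ?_ ?_
  · exact .of_forall fun k => (by fun_prop : Continuous _).aestronglyMeasurable
  · filter_upwards [tendsto_natCast_atTop_atTop.eventually_ge_atTop (2 * |δ| + 2)] with k hk
    filter_upwards [ae_quadrant_nonneg] with p hp
    rw [norm_norm]
    refine (norm_sub_le _ _).trans (add_le_add ?_ ?_)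
    · rw [Real.norm_of_nonneg (extremesDensity_nonneg _ _ _)]
      exact extremesDensity_le hk hp.1 hp.2
    · rw [Real.norm_of_nonneg (by positivity)]
  · exact ((integrable_exp_mul_exp_quadrant (b := 1 / 2) (by norm_num)).const_mul 4).add
      integrable_exp_neg_mul_exp_neg_quadrant
  · refine ae_of_all _ fun p => ?_
    simpa using ((tendsto_extremesDensity δ p).sub_const
      (Real.exp (-p.1) * Real.exp (-p.2))).norm

/-- Convergence in total variation of the joint law of the normalized extreme order
statistics of the shifted and scaled uniform sample `Z_{n,i} = (1 + (θ₂-θ₁)/n)·U_i + θ₁/n`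
to the law of `(X₁ + θ₁, -X₂ + θ₂)` for independent standard exponentials `X₁, X₂`. -/
theorem stmt18 (θ₁ θ₂ : ℝ) :
    Tendsto (fun n : ℕ =>
      ⨆ A : {A : Set (ℝ × ℝ) // MeasurableSet A},
        abs
          (((((Measure.pi fun _ : Fin n => volume.restrict (Set.Icc (0:ℝ) 1))).map
              (fun u : Fin n → ℝ =>
                ((n : ℝ) * (⨅ i, ((1 + (θ₂ - θ₁) / n) * u i + θ₁ / n)),
                 (n : ℝ) * ((⨆ i, ((1 + (θ₂ - θ₁) / n) * u i + θ₁ / n)) - 1)))) A.1).toReal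
            - (((expM.prod expM).map fun p => (p.1 + θ₁, -p.2 + θ₂)) A.1).toReal))
      atTop (𝓝 0) := by
  rw [← tendsto_add_atTop_iff_nat 2]
  refine squeeze_zero' (.of_forall fun k => Real.iSup_nonneg fun A => abs_nonneg _) ?_
    (tendsto_integral_norm_extremesDensity_sub (θ₂ - θ₁))
  filter_upwards [eventually_ge_atTop 1,
    tendsto_natCast_atTop_atTop.eventually_ge_atTop (2 * |θ₂ - θ₁| + 2)] with k hk1 hk
  have hN : 0 < ((k + 2 : ℕ) : ℝ) + (θ₂ - θ₁) := by
    push_cast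
    linarith [neg_abs_le (θ₂ - θ₁), abs_nonneg (θ₂ - θ₁)]
  have : Nonempty {A : Set (ℝ × ℝ) // MeasurableSet A} := ⟨⟨∅, .empty⟩⟩
  refine ciSup_le fun A => ?_
  have hφ : Measurable fun p : ℝ × ℝ => (p.1 + θ₁, -p.2 + θ₂) := by fun_prop
  have hlaw := congrArg (Measure.map fun p : ℝ × ℝ => (p.1 + θ₁, -p.2 + θ₂))
    (map_extremes_eq_withDensity θ₁ θ₂ hk1 hN)
  rw [Measure.map_map hφ] at hlaw
  · simp only [Function.comp_def, sub_add_cancel, neg_sub] at hlaw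
    rw [hlaw, expM_prod_expM, Measure.map_apply hφ A.2, Measure.map_apply hφ A.2]
    exact abs_withDensity_sub_withDensity_le (integrable_extremesDensity hk)
      integrable_exp_neg_mul_exp_neg_quadrant (extremesDensity_nonneg _ _)
      (fun p => by positivity) (hφ A.2)
  · refine Measurable.prodMk ?_ ?_
    · exact ((Measurable.iInf fun i => by fun_prop).const_mul _).sub_const _
    · exact (((Measurable.iSup fun i => by fun_prop).sub_const _).const_mul _).const_sub _
end
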